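/- arXiv:1702.08877 — 2 statements merged into one kernel-verified Lean document; each statement's English description precedes it below -/
import Mathlib

section
/- Let A be a unital associative algebra over a commutative unital ring R that is 2-torsion free and (n−1)-torsion free, let e be a nontrivial idempotent in A and f = 1 − e, suppose A satisfies property (Q), let n ≥ 2, and let φ be a Lie n-derivation on A. If (i) fφ(a)f ∈ fZ(A)f for every a ∈ eAe and eφ(b)e ∈ eZ(A)e for every b ∈ fAf, and (ii) eAe has no nonzero central ideal or fAf has no nonzero central ideal, then φ = d + δ + γ, where d is a derivation on A, δ is a singular Jordan derivation on A that is also an antiderivation, and γ is an R-linear map from A into Z(A) vanishing on all (n−1)-th commutators of A. -/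
open Finset

/-- Iterated commutator: `pCom x k = p_{k+1}(x 0, ..., x k)`, i.e.
`pCom x 0 = x 0` and `pCom x (k+1) = [pCom x k, x (k+1)]`. -/
def pCom {A : Type*} [Ring A] (x : ℕ → A) : ℕ → A
  | 0 => x 0
  | k + 1 => pCom x k * x (k + 1) - x (k + 1) * pCom x k

/-- `φ` is a Lie `n`-derivation. -/
def IsLieNDeriv {R : Type*} {A : Type*} [CommRing R] [Ring A] [Algebra R A]
    (n : ℕ) (φ : A →ₗ[R] A) : Prop :=
  ∀ x : ℕ → A,
    φ (pCom x (n - 1)) =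
      ∑ i ∈ Finset.range n, pCom (Function.update x i (φ (x i))) (n - 1)

/-- `d` is a derivation. -/
def IsDeriv {R : Type*} {A : Type*} [CommRing R] [Ring A] [Algebra R A]
    (d : A →ₗ[R] A) : Prop :=
  ∀ x y : A, d (x * y) = d x * y + x * d y

/-- `δ` is a Jordan derivation. -/
def IsJordanDeriv {R : Type*} {A : Type*} [CommRing R] [Ring A] [Algebra R A]
    (δ : A →ₗ[R] A) : Prop :=
  ∀ x y : A, δ (x * y + y * x) = δ x * y + y * δ x + x * δ y + δ y * x

/-- `δ` is an antiderivation. -/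
def IsAntiDeriv {R : Type*} {A : Type*} [CommRing R] [Ring A] [Algebra R A]
    (δ : A →ₗ[R] A) : Prop :=
  ∀ x y : A, δ (x * y) = δ y * x + y * δ x

/-- `δ` is a singular Jordan derivation relative to the idempotent `e`
(with `f = 1 - e`): it is a Jordan derivation killing `eAe` and `fAf`,
mapping `eAf` into `fAe` and `fAe` into `eAf`. -/
def IsSingularJordanDeriv {R : Type*} {A : Type*} [CommRing R] [Ring A] [Algebra R A]
    (e : A) (δ : A →ₗ[R] A) : Prop :=
  IsJordanDeriv δ ∧
  (∀ a : A, δ (e * a * e) = 0) ∧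
  (∀ b : A, δ ((1 - e) * b * (1 - e)) = 0) ∧
  (∀ m : A, δ (e * m * (1 - e)) = (1 - e) * δ (e * m * (1 - e)) * e) ∧
  (∀ t : A, δ ((1 - e) * t * e) = e * δ ((1 - e) * t * e) * (1 - e))

/-- `z` is a central element. -/
def IsCent {A : Type*} [Ring A] (z : A) : Prop := ∀ y : A, z * y = y * z

/-- The centre of `A` as a set. -/
def centerSet (A : Type*) [Ring A] : Set A := {z : A | ∀ y : A, z * y = y * z}

/-- `γ` vanishes on all `(n-1)`-th commutators. -/
def VanishesOnNCommutators {R : Type*} {A : Type*} [CommRing R] [Ring A] [Algebra R A]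
    (n : ℕ) (γ : A →ₗ[R] A) : Prop :=
  ∀ x : ℕ → A, γ (pCom x (n - 1)) = 0

/-- A Lie `n`-derivation is standard if it is the sum of a derivation and a
central-valued map vanishing on all `(n-1)`-th commutators. -/
def IsStandardLieNDeriv {R : Type*} {A : Type*} [CommRing R] [Ring A] [Algebra R A]
    (n : ℕ) (φ : A →ₗ[R] A) : Prop :=
  ∃ d γ : A →ₗ[R] A,
    IsDeriv d ∧ (∀ x : A, IsCent (γ x)) ∧ VanishesOnNCommutators n γ ∧ φ = d + γ

/-- Property (Q) for the idempotent `e` (with `f = 1 - e`):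
`exe·eAf = 0 = fAe·exe` implies `exe = 0`, and
`eAf·fxf = 0 = fxf·fAe` implies `fxf = 0`. -/
def PropQ {A : Type*} [Ring A] (e : A) : Prop :=
  (∀ x : A,
    ((∀ y : A, (e * x * e) * (e * y * (1 - e)) = 0) ∧
     (∀ y : A, ((1 - e) * y * e) * (e * x * e) = 0)) → e * x * e = 0) ∧
  (∀ x : A,
    ((∀ y : A, (e * y * (1 - e)) * ((1 - e) * x * (1 - e)) = 0) ∧
     (∀ y : A, ((1 - e) * x * (1 - e)) * ((1 - e) * y * e) = 0)) →
        (1 - e) * x * (1 - e) = 0)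

/-- `A` is `k`-torsion free. -/
def TorsionFreeAt (A : Type*) [Ring A] (k : ℕ) : Prop :=
  ∀ x : A, k • x = 0 → x = 0

/-- The centre of the corner algebra `gAg` (for an idempotent `g`). -/
def cornerCenter {A : Type*} [Ring A] (g : A) : Set A :=
  {z : A | z = g * z * g ∧ ∀ a : A, z * (g * a * g) = (g * a * g) * z}

/-- The corner algebra `gAg` has no nonzero central ideal: every
ideal of `gAg` consisting of elements central in `gAg` is zero. -/
def NoNonzeroCentralIdeal (R : Type*) [CommRing R] (A : Type*) [Ring A] [Algebra R A]
    (g : A) : Prop :=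
  ∀ I : Set A, (0 : A) ∈ I →
    (∀ x ∈ I, x = g * x * g) →
    (∀ x ∈ I, ∀ y ∈ I, x + y ∈ I) →
    (∀ r : R, ∀ x ∈ I, r • x ∈ I) →
    (∀ x ∈ I, ∀ a : A, (g * a * g) * x ∈ I) →
    (∀ x ∈ I, ∀ a : A, x * (g * a * g) ∈ I) →
    (∀ x ∈ I, ∀ a : A, x * (g * a * g) = (g * a * g) * x) →
    ∀ x ∈ I, x = 0

/-- The generating set of `S(gAg)`: all idempotents of `gAg` together with all
commutators of elements of `gAg`. -/
def cornerGenSet {A : Type*} [Ring A] (g : A) : Set A :=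
  {x : A | x = g * x * g ∧ x * x = x} ∪
  {x : A | ∃ a b : A, x = (g * a * g) * (g * b * g) - (g * b * g) * (g * a * g)}

/-- `gAg = S(gAg)`: the corner algebra is generated (as an algebra) by its
idempotents and commutators. -/
def CornerGenerated (R : Type*) [CommRing R] {A : Type*} [Ring A] [Algebra R A]
    (g : A) : Prop :=
  ∀ x : A, g * x * g ∈ NonUnitalAlgebra.adjoin R (cornerGenSet g)

/-- Condition (*) for the corner algebra `gAg`: if `[x, gAg] ⊆ Z(gAg)` then
`x ∈ Z(gAg)`. -/
def CornerCondStar {A : Type*} [Ring A] (g : A) : Prop :=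
  ∀ x : A, x = g * x * g →
    (∀ a : A, x * (g * a * g) - (g * a * g) * x ∈ cornerCenter g) →
    x ∈ cornerCenter g

/-- The Leibniz sum of a map `g` along the iterated commutator `pCom x k`. -/
def comLeibniz {A : Type*} [Ring A] (g : A → A) (x : ℕ → A) : ℕ → A
  | 0 => g (x 0)
  | k + 1 => (comLeibniz g x k * x (k + 1) - x (k + 1) * comLeibniz g x k) +
      (pCom x k * g (x (k + 1)) - g (x (k + 1)) * pCom x k)

/-- The sequence `u, v, w, e, e, e, …`. -/
def tailSeq {A : Type*} (u v w e : A) : ℕ → A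
  | 0 => u
  | 1 => v
  | 2 => w
  | _ => e

/-- `x` lies in the Peirce component `gAh`. -/
def Peirce {A : Type*} [Ring A] (g h x : A) : Prop := g * x = x ∧ x * h = x

section Commutators

variable {A : Type*} [Ring A]

theorem pCom_update_of_lt (x : ℕ → A) (v : A) {i k : ℕ} (h : k < i) :
    pCom (Function.update x i v) k = pCom x k := by
  induction k with
  | zero => simp [pCom, Function.update_of_ne h.ne]
  | succ k ih => simp [pCom, ih (by omega), Function.update_of_ne h.ne]

theorem sum_pCom_update (g : A → A) (x : ℕ → A) (k : ℕ) :
    ∑ i ∈ Finset.range (k + 1), pCom (Function.update x i (g (x i))) k = comLeibniz g x k := by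
  induction k with
  | zero => simp [pCom, comLeibniz]
  | succ k ih =>
    rw [Finset.sum_range_succ, comLeibniz, ← ih, Finset.sum_mul, Finset.mul_sum,
      ← Finset.sum_sub_distrib]
    congr 1
    · refine Finset.sum_congr rfl fun i hi => ?_
      have hik : k + 1 ≠ i := by have := Finset.mem_range.mp hi; omega
      simp [pCom, Function.update_of_ne hik]
    · simp [pCom, pCom_update_of_lt x _ (Nat.lt_succ_self k)]

theorem comLeibniz_add (g h : A → A) (x : ℕ → A) (k : ℕ) :
    comLeibniz (fun y => g y + h y) x k = comLeibniz g x k + comLeibniz h x k := by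
  induction k with
  | zero => simp [comLeibniz]
  | succ k ih => simp only [comLeibniz, ih]; noncomm_ring

theorem comLeibniz_of_deriv (d : A → A) (hsub : ∀ x y, d (x - y) = d x - d y)
    (hd : ∀ x y, d (x * y) = d x * y + x * d y) (x : ℕ → A) (k : ℕ) :
    comLeibniz d x k = d (pCom x k) := by
  induction k with
  | zero => rfl
  | succ k ih => simp only [comLeibniz, pCom, ih, hsub, hd]; noncomm_ring

theorem comLeibniz_of_central (c : A → A) (hc : ∀ x y, c x * y = y * c x) (x : ℕ → A) {k : ℕ}
    (hk : 1 ≤ k) : comLeibniz c x k = 0 := by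
  induction k, hk using Nat.le_induction with
  | base => simp [comLeibniz, pCom, hc]
  | succ k _ ih => simp [comLeibniz, ih, hc]

theorem comLeibniz_of_antideriv (δ : A → A) (hsub : ∀ x y, δ (x - y) = δ x - δ y)
    (hδ : ∀ x y, δ (x * y) = δ y * x + y * δ x)
    (hcomm : ∀ x y z, (x * y - y * x) * δ z = δ z * (x * y - y * x)) (x : ℕ → A) (k : ℕ) :
    comLeibniz δ x k = (-1 : ℤ) ^ k • δ (pCom x k) := by
  induction k with
  | zero => simp [comLeibniz, pCom]
  | succ k ih =>
    rcases k with _ | k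
    · simp only [comLeibniz, pCom, hsub, hδ, zero_add, pow_one, neg_smul, one_smul]
      abel
    · have hz : pCom x (k + 1) * δ (x (k + 1 + 1)) = δ (x (k + 1 + 1)) * pCom x (k + 1) :=
        hcomm _ _ _
      rw [comLeibniz, ih, hz, sub_self, add_zero]
      conv_rhs => rw [pCom, hsub, hδ, hδ, hz, pow_succ]
      simp only [smul_mul_assoc, mul_smul_comm, mul_neg, mul_one, neg_smul, smul_sub, smul_add]
      abel

end Commutators

section PeirceComponents

variable {A : Type*} [Ring A] {e f g h k l x y : A}

theorem Peirce.mul (hx : Peirce g h x) (hy : Peirce k l y) : Peirce g l (x * y) :=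
  ⟨by rw [← mul_assoc, hx.1], by rw [mul_assoc, hy.2]⟩

theorem Peirce.add (hx : Peirce g h x) (hy : Peirce g h y) : Peirce g h (x + y) :=
  ⟨by rw [mul_add, hx.1, hy.1], by rw [add_mul, hx.2, hy.2]⟩

theorem Peirce.sub (hx : Peirce g h x) (hy : Peirce g h y) : Peirce g h (x - y) :=
  ⟨by rw [mul_sub, hx.1, hy.1], by rw [sub_mul, hx.2, hy.2]⟩

theorem Peirce.mul_eq_zero (hx : Peirce g h x) (hy : Peirce k l y) (hhk : h * k = 0) :
    x * y = 0 := by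
  rw [← hx.2, ← hy.1, mul_assoc, ← mul_assoc h, hhk, zero_mul, mul_zero]

theorem Peirce.corner (hg : g * g = g) (hh : h * h = h) (x : A) : Peirce g h (g * x * h) :=
  ⟨by rw [← mul_assoc, ← mul_assoc, hg], by rw [mul_assoc, hh]⟩

theorem Peirce.corner_eq (hx : Peirce g h x) : g * x * h = x := by rw [hx.1, hx.2]

theorem Peirce.left_zero (hx : Peirce g h x) (hk : k * g = 0) : k * x = 0 := by
  rw [← hx.1, ← mul_assoc, hk, zero_mul]

theorem Peirce.right_zero (hx : Peirce g h x) (hk : h * k = 0) : x * k = 0 := by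
  rw [← hx.2, mul_assoc, hk, mul_zero]

/-- `e` and `f` are complementary orthogonal idempotents. -/
structure ComplIdem (e f : A) : Prop where
  ee : e * e = e
  ff : f * f = f
  ef : e * f = 0
  fe : f * e = 0
  sum : e + f = 1

theorem ComplIdem.symm (H : ComplIdem e f) : ComplIdem f e :=
  ⟨H.ff, H.ee, H.fe, H.ef, by rw [add_comm, H.sum]⟩

theorem ComplIdem.decomp (H : ComplIdem e f) (x : A) :
    x = e * x * e + e * x * f + f * x * e + f * x * f := by
  have : x = (e + f) * x * (e + f) := by rw [H.sum, one_mul, mul_one]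
  conv_lhs => rw [this]
  noncomm_ring

/-- Biadditive maps vanish once they vanish on Peirce components. -/
theorem ComplIdem.biadditive_ext (H : ComplIdem e f) (F : A → A → A)
    (hl : ∀ x x' y, F (x + x') y = F x y + F x' y) (hr : ∀ x y y', F x (y + y') = F x y + F x y')
    (h0 : ∀ g h k l, (g = e ∨ g = f) → (h = e ∨ h = f) → (k = e ∨ k = f) → (l = e ∨ l = f) →
      ∀ x y, Peirce g h x → Peirce k l y → F x y = 0) (x y : A) : F x y = 0 := by
  have c : ∀ g h : A, (g = e ∨ g = f) → (h = e ∨ h = f) → ∀ x, Peirce g h (g * x * h) := by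
    rintro g h (rfl | rfl) (rfl | rfl) x <;> apply Peirce.corner <;>
      first | exact H.ee | exact H.ff
  have h1 : ∀ g h : A, (g = e ∨ g = f) → (h = e ∨ h = f) → ∀ x, Peirce g h x → F x y = 0 := by
    intro g h hg hh x hx
    rw [H.decomp y, hr, hr, hr]
    rw [h0 g h e e hg hh (.inl rfl) (.inl rfl) x _ hx (c _ _ (.inl rfl) (.inl rfl) y),
      h0 g h e f hg hh (.inl rfl) (.inr rfl) x _ hx (c _ _ (.inl rfl) (.inr rfl) y),
      h0 g h f e hg hh (.inr rfl) (.inl rfl) x _ hx (c _ _ (.inr rfl) (.inl rfl) y),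
      h0 g h f f hg hh (.inr rfl) (.inr rfl) x _ hx (c _ _ (.inr rfl) (.inr rfl) y)]
    simp
  rw [H.decomp x, hl, hl, hl,
    h1 e e (.inl rfl) (.inl rfl) _ (c _ _ (.inl rfl) (.inl rfl) x),
    h1 e f (.inl rfl) (.inr rfl) _ (c _ _ (.inl rfl) (.inr rfl) x),
    h1 f e (.inr rfl) (.inl rfl) _ (c _ _ (.inr rfl) (.inl rfl) x),
    h1 f f (.inr rfl) (.inr rfl) _ (c _ _ (.inr rfl) (.inr rfl) x)]
  simp

/-- The corner `eAe` acts faithfully on the off-diagonal Peirce components. -/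
def FaithfulCorner (e f : A) : Prop :=
  ∀ a, Peirce e e a → (∀ m, Peirce e f m → a * m = 0) → (∀ t, Peirce f e t → t * a = 0) → a = 0

theorem IsCent.corner_comm {z : A} (hz : IsCent z) (hx : Peirce e e x) (he : e * e = e) :
    (e * z * e) * x = x * (e * z * e) := by
  have : e * z * e = z * e := by rw [← hz e, mul_assoc, he]
  rw [this, mul_assoc, hx.1, ← mul_assoc, ← hz x, mul_assoc, hx.2]

theorem IsCent.eq_zero_of_corner {z : A} (hz : IsCent z) (H : ComplIdem e f)
    (Q : FaithfulCorner f e) (h0 : e * z * e = 0) : z = 0 := by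
  have hze : z * e = 0 := by rw [← h0, ← hz e, mul_assoc, H.ee]
  have hzf : z * f = 0 := by
    refine Q _ ⟨?_, ?_⟩ (fun t ht => ?_) (fun m hm => ?_)
    · rw [← mul_assoc, ← hz f, mul_assoc, H.ff]
    · rw [mul_assoc, H.ff]
    · rw [mul_assoc, ht.1, ← ht.2, ← mul_assoc, hz t, mul_assoc, hze, mul_zero]
    · rw [← mul_assoc, ← hz m, mul_assoc, hm.2, ← hm.1, ← mul_assoc, hze, zero_mul]
  rw [← mul_one z, ← H.sum, mul_add, hze, hzf, add_zero]

theorem isCent_of_commute (H : ComplIdem e f) (Q : FaithfulCorner e f) (Q' : FaithfulCorner f e)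
    {c : A} (hc : c * e = e * c) (hm : ∀ m, Peirce e f m → c * m = m * c)
    (ht : ∀ t, Peirce f e t → c * t = t * c) : IsCent c := by
  have key : ∀ {e f : A}, FaithfulCorner e f → c * e = e * c →
      (∀ m, Peirce e f m → c * m = m * c) → (∀ t, Peirce f e t → c * t = t * c) →
      ∀ a, Peirce e e a → c * a = a * c := by
    intro e f Q hc hm ht a ha
    rw [← sub_eq_zero]
    refine Q _ ⟨?_, ?_⟩ (fun m h => ?_) (fun t h => ?_)
    · rw [mul_sub, ← mul_assoc, ← mul_assoc, ← hc, ha.1, mul_assoc, ha.1]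
    · rw [sub_mul, mul_assoc, mul_assoc, hc, ha.2, ← mul_assoc, ha.2]
    · rw [sub_mul, mul_assoc, mul_assoc, hm m h, hm (a * m) (ha.mul h), mul_assoc, sub_self]
    · rw [mul_sub, ← mul_assoc, ← mul_assoc, ← ht t h, ← ht (t * a) (h.mul ha), mul_assoc,
        sub_self]
  have hf : f = 1 - e := by rw [← H.sum, add_sub_cancel_left]
  have hcf : c * f = f * c := by rw [hf, mul_sub, sub_mul, hc, mul_one, one_mul]
  intro x
  have h1 := key Q hc hm ht _ (Peirce.corner H.ee H.ee x)
  have h2 := key Q' hcf ht hm _ (Peirce.corner H.ff H.ff x)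
  have h3 := hm _ (Peirce.corner H.ee H.ff x)
  have h4 := ht _ (Peirce.corner H.ff H.ee x)
  rw [H.decomp x, mul_add, mul_add, mul_add, h1, h2, h3, h4, add_mul, add_mul, add_mul]

theorem NoNonzeroCentralIdeal.eq_zero {R : Type*} [CommRing R] [Algebra R A]
    (N : NoNonzeroCentralIdeal R A e) (he : e * e = e) {u : A} (hu : Peirce e e u)
    (h : ∀ a b, Peirce e e a → Peirce e e b → (a * u) * b = b * (a * u)) : u = 0 := by
  have hee : Peirce e e e := ⟨he, he⟩
  refine N {z | ∃ a, Peirce e e a ∧ z = a * u} ⟨0, ⟨mul_zero _, zero_mul _⟩, by simp⟩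
    ?_ ?_ ?_ ?_ ?_ ?_ u ⟨e, hee, hu.1.symm⟩
  · rintro _ ⟨a, ha, rfl⟩
    exact (ha.mul hu).corner_eq.symm
  · rintro _ ⟨a, ha, rfl⟩ _ ⟨b, hb, rfl⟩
    exact ⟨a + b, ha.add hb, (add_mul _ _ _).symm⟩
  · rintro r _ ⟨a, ha, rfl⟩
    exact ⟨r • a, ⟨by rw [mul_smul_comm, ha.1], by rw [smul_mul_assoc, ha.2]⟩,
      (smul_mul_assoc _ _ _).symm⟩
  · rintro _ ⟨a, ha, rfl⟩ b
    exact ⟨_, (Peirce.corner he he b).mul ha, (mul_assoc _ _ _).symm⟩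
  · rintro _ ⟨a, ha, rfl⟩ b
    exact ⟨_, (Peirce.corner he he b).mul ha,
      (h a _ ha (Peirce.corner he he b)).trans (mul_assoc _ _ _).symm⟩
  · rintro _ ⟨a, ha, rfl⟩ b
    exact h a _ ha (Peirce.corner he he b)

end PeirceComponents

section AntiDerivations

variable {R : Type*} {A : Type*} [CommRing R] [Ring A] [Algebra R A] {δ : A →ₗ[R] A}

theorem IsAntiDeriv.isJordanDeriv (h : IsAntiDeriv δ) : IsJordanDeriv δ := by
  intro x y
  rw [map_add, h, h]
  abel

theorem IsAntiDeriv.mul_commutator (h : IsAntiDeriv δ) (x y z : A) :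
    δ z * (x * y - y * x) = (y * z - z * y) * δ x := by
  have h1 := h (x * y) z
  rw [mul_assoc, h, h, h] at h1
  have h2 : δ z * (x * y - y * x) - (y * z - z * y) * δ x =
      δ z * (x * y) + z * (δ y * x + y * δ x) - ((δ z * y + z * δ y) * x + y * z * δ x) := by
    noncomm_ring
  rw [← sub_eq_zero, h2, h1, sub_self]

theorem IsAntiDeriv.commute_commutator (h : IsAntiDeriv δ) (x y z : A) :
    (x * y - y * x) * δ z = δ z * (x * y - y * x) := by
  have cyc : (x * y - y * x) * δ z = (y * z - z * y) * δ x := by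
    rw [← h.mul_commutator z x y, ← neg_sub (x * z), mul_neg, h.mul_commutator x z y, ← neg_mul,
      neg_sub]
  rw [cyc, h.mul_commutator]

end AntiDerivations

section Reduced

variable {R : Type*} {A : Type*} [CommRing R] [Ring A] [Algebra R A]

/-- A Lie `n`-derivation `ψ + γ` with `γ` central-valued, supported on the diagonal corners, such
that `ψ` preserves both diagonal corners and the off-diagonal part, and kills `e` and `f`. -/
structure ReducedLieNDeriv (n : ℕ) (e f : A) (ψ γ : A →ₗ[R] A) : Prop where
  two_le : 2 ≤ n
  idem : ComplIdem e f
  faithful : FaithfulCorner e f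
  faithful' : FaithfulCorner f e
  central : ∀ x, IsCent (γ x)
  γ_ef : ∀ x, Peirce e f x → γ x = 0
  γ_fe : ∀ x, Peirce f e x → γ x = 0
  ψ_ee : ∀ x, Peirce e e x → Peirce e e (ψ x)
  ψ_ff : ∀ x, Peirce f f x → Peirce f f (ψ x)
  ψ_ef : ∀ x, Peirce e f x → e * ψ x * e = 0 ∧ f * ψ x * f = 0
  ψ_fe : ∀ x, Peirce f e x → e * ψ x * e = 0 ∧ f * ψ x * f = 0
  ψ_e : ψ e = 0
  ψ_f : ψ f = 0
  lie : ∀ x, ψ (pCom x (n - 1)) + γ (pCom x (n - 1)) = comLeibniz ψ x (n - 1)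

namespace ReducedLieNDeriv

variable {n : ℕ} {e f : A} {ψ γ : A →ₗ[R] A}

theorem symm (H : ReducedLieNDeriv n e f ψ γ) : ReducedLieNDeriv n f e ψ γ where
  two_le := H.two_le
  idem := H.idem.symm
  faithful := H.faithful'
  faithful' := H.faithful
  central := H.central
  γ_ef := H.γ_fe
  γ_fe := H.γ_ef
  ψ_ee := H.ψ_ff
  ψ_ff := H.ψ_ee
  ψ_ef x hx := (H.ψ_fe x hx).symm
  ψ_fe x hx := (H.ψ_ef x hx).symm
  ψ_e := H.ψ_f
  ψ_f := H.ψ_e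
  lie := H.lie

theorem ef_part (H : ReducedLieNDeriv n e f ψ γ) (x : A) : Peirce e f (e * ψ x * f) :=
  Peirce.corner H.idem.ee H.idem.ff _

theorem fe_part (H : ReducedLieNDeriv n e f ψ γ) (x : A) : Peirce f e (f * ψ x * e) :=
  Peirce.corner H.idem.ff H.idem.ee _

theorem ψ_eq (H : ReducedLieNDeriv n e f ψ γ) {m : A} (hm : Peirce e f m) :
    ψ m = e * ψ m * f + f * ψ m * e := by
  have := H.idem.decomp (ψ m)
  rwa [(H.ψ_ef m hm).1, (H.ψ_ef m hm).2, zero_add, add_zero] at this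

theorem tail (H : ReducedLieNDeriv n e f ψ γ) (x : ℕ → A) {j k : ℕ} (hjk : j + k = n - 1)
    (hx : ∀ i, j < i → x i = e) (hp : Peirce e f (pCom x j)) :
    e * ψ (pCom x j) * f = e * comLeibniz ψ x j * f ∧
      (-1 : ℤ) ^ k • (f * ψ (pCom x j) * e) = f * comLeibniz ψ x j * e := by
  have key : ∀ i, pCom x (j + i) = (-1 : ℤ) ^ i • pCom x j ∧
      e * comLeibniz ψ x (j + i) * f = (-1 : ℤ) ^ i • (e * comLeibniz ψ x j * f) ∧
      f * comLeibniz ψ x (j + i) * e = f * comLeibniz ψ x j * e := by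
    intro i
    induction i with
    | zero => simp
    | succ i ih =>
      have hxe : x (j + i + 1) = e := hx _ (by omega)
      refine ⟨?_, ?_, ?_⟩
      · rw [← add_assoc, pCom, hxe, ih.1, smul_mul_assoc, mul_smul_comm, hp.1,
          hp.right_zero H.idem.fe, pow_succ]
        simp
      · rw [← add_assoc, comLeibniz, hxe, H.ψ_e, pow_succ, mul_neg_one, neg_smul, ← ih.2.1]
        have : e * (comLeibniz ψ x (j + i) * e - e * comLeibniz ψ x (j + i) +
            (pCom x (j + i) * 0 - 0 * pCom x (j + i))) * f =
            e * comLeibniz ψ x (j + i) * (e * f) - (e * e) * comLeibniz ψ x (j + i) * f := by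
          noncomm_ring
        rw [this, H.idem.ef, H.idem.ee]
        simp
      · rw [← add_assoc, comLeibniz, hxe, H.ψ_e, ← ih.2.2]
        have : f * (comLeibniz ψ x (j + i) * e - e * comLeibniz ψ x (j + i) +
            (pCom x (j + i) * 0 - 0 * pCom x (j + i))) * e =
            f * comLeibniz ψ x (j + i) * (e * e) - (f * e) * comLeibniz ψ x (j + i) * e := by
          noncomm_ring
        rw [this, H.idem.fe, H.idem.ee]
        simp
  have hl := H.lie x
  obtain ⟨h1, h2, h3⟩ := key k
  rw [← hjk, h1, map_zsmul, map_zsmul, H.γ_ef _ hp, smul_zero, add_zero] at hl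
  rw [← hl, mul_smul_comm, smul_mul_assoc] at h2 h3
  refine ⟨?_, h3⟩
  rcases neg_one_pow_eq_or ℤ k with h | h <;> rw [h] at h2 <;> simpa using h2

theorem antisymm_parity (H : ReducedLieNDeriv n e f ψ γ) {m : A} (hm : Peirce e f m) :
    (-1 : ℤ) ^ (n - 1) • (f * ψ m * e) = f * ψ m * e :=
  (H.tail (tailSeq m e e e) (j := 0) (zero_add _)
    (fun i hi => by rcases i with _ | _ | _ | i <;> first | omega | rfl) hm).2

theorem tail_one (H : ReducedLieNDeriv n e f ψ γ) {u v : A} (hp : Peirce e f (u * v - v * u)) :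
    e * ψ (u * v - v * u) * f =
      e * (ψ u * v - v * ψ u + (u * ψ v - ψ v * u)) * f ∧
    f * ψ (u * v - v * u) * e =
      -(f * (ψ u * v - v * ψ u + (u * ψ v - ψ v * u)) * e) := by
  have h := H.tail (tailSeq u v e e) (j := 1) (k := n - 2) (by have := H.two_le; omega)
    (fun i hi => by rcases i with _ | _ | _ | i <;> first | omega | rfl) hp
  refine ⟨h.1, ?_⟩
  have h2 : _ = f * (ψ u * v - v * ψ u + (u * ψ v - ψ v * u)) * e := h.2
  have h3 := H.antisymm_parity hp
  have h4 : n - 1 = (n - 2) + 1 := by have := H.two_le; omega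
  rw [← h2, ← neg_smul]
  rw [h4, pow_succ, mul_neg_one] at h3
  exact h3.symm

theorem ψ_ee_mul_ef (H : ReducedLieNDeriv n e f ψ γ) {a m : A} (ha : Peirce e e a)
    (hm : Peirce e f m) :
    e * ψ (a * m) * f = ψ a * m + a * (e * ψ m * f) ∧ f * ψ (a * m) * e = f * ψ m * e * a := by
  have hma : m * a = 0 := hm.mul_eq_zero ha H.idem.fe
  have hpa := H.ψ_ee a ha
  have h := H.tail_one (u := a) (v := m) (by rw [hma, sub_zero]; exact ha.mul hm)
  rw [hma, sub_zero, hm.mul_eq_zero hpa H.idem.fe, sub_zero] at h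
  constructor
  · rw [h.1]
    have : e * (ψ a * m + (a * ψ m - ψ m * a)) * f =
        (e * ψ a) * (m * f) + (e * a) * ψ m * f - e * ψ m * (a * f) := by noncomm_ring
    rw [this, hpa.1, hm.2, ha.1, ha.right_zero H.idem.ef, mul_zero, sub_zero]
    have h4 : a * (e * ψ m * f) = a * e * ψ m * f := by noncomm_ring
    rw [h4, ha.2]
  · rw [h.2]
    have : -(f * (ψ a * m + (a * ψ m - ψ m * a)) * e) =
        -(f * ψ a * (m * e)) - (f * a) * ψ m * e + f * ψ m * (a * e) := by noncomm_ring
    rw [this, hm.right_zero H.idem.fe, ha.left_zero H.idem.fe, ha.2]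
    conv_rhs => rw [mul_assoc, ha.1]
    simp

theorem ψ_ef_mul_ff (H : ReducedLieNDeriv n e f ψ γ) {m b : A} (hm : Peirce e f m)
    (hb : Peirce f f b) :
    e * ψ (m * b) * f = e * ψ m * f * b + m * ψ b ∧ f * ψ (m * b) * e = b * (f * ψ m * e) := by
  have hbm : b * m = 0 := hb.mul_eq_zero hm H.idem.fe
  have hpb := H.ψ_ff b hb
  have h := H.tail_one (u := m) (v := b) (by rw [hbm, sub_zero]; exact hm.mul hb)
  rw [hbm, sub_zero, hpb.mul_eq_zero hm H.idem.fe, sub_zero] at h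
  constructor
  · rw [h.1]
    have : e * (ψ m * b - b * ψ m + m * ψ b) * f =
        e * ψ m * (b * f) - (e * b) * ψ m * f + (e * m) * (ψ b * f) := by noncomm_ring
    rw [this, hb.2, hb.left_zero H.idem.ef, hm.1, hpb.2]
    conv_rhs => rw [mul_assoc, hb.1]
    simp
  · rw [h.2]
    have : -(f * (ψ m * b - b * ψ m + m * ψ b) * e) =
        -(f * ψ m * (b * e)) + (f * b) * ψ m * e - (f * m) * ψ b * e := by noncomm_ring
    rw [this, hb.right_zero H.idem.fe, hb.1, hm.left_zero H.idem.fe]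
    conv_rhs => rw [← mul_assoc, ← mul_assoc, hb.2]
    simp

theorem ψ_ee_mul_ee (H : ReducedLieNDeriv n e f ψ γ) {a a' : A} (ha : Peirce e e a)
    (ha' : Peirce e e a') : ψ (a * a') = ψ a * a' + a * ψ a' := by
  have hp := H.ψ_ee a ha
  have hp' := H.ψ_ee a' ha'
  rw [← sub_eq_zero]
  refine H.faithful _ ((H.ψ_ee _ (ha.mul ha')).sub ((hp.mul ha').add (ha.mul hp')))
    (fun m hm => ?_) (fun t ht => ?_)
  · have h1 := (H.ψ_ee_mul_ef (ha.mul ha') hm).1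
    have h2 := (H.ψ_ee_mul_ef ha (ha'.mul hm)).1
    rw [(H.ψ_ee_mul_ef ha' hm).1, ← mul_assoc, h1] at h2
    rw [sub_mul, sub_eq_zero]
    have h3 : ψ (a * a') * m = ψ a * (a' * m) + a * (ψ a' * m + a' * (e * ψ m * f)) -
      a * a' * (e * ψ m * f) := by rw [← h2]; abel
    rw [h3]; noncomm_ring
  · have h1 := (H.symm.ψ_ef_mul_ff ht (ha.mul ha')).1
    have h2 := (H.symm.ψ_ef_mul_ff (ht.mul ha) ha').1
    rw [(H.symm.ψ_ef_mul_ff ht ha).1, mul_assoc t a a', h1] at h2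
    rw [mul_sub, sub_eq_zero]
    have h3 : t * ψ (a * a') = (f * ψ t * e * a + t * ψ a) * a' + t * a * ψ a' -
      f * ψ t * e * (a * a') := by rw [← h2]; abel
    rw [h3]; noncomm_ring

/-- On commutators of a block-diagonal element with an off-diagonal one, the defect of the Leibniz
rule vanishes in the off-diagonal corner. -/
theorem ψ_diag_comm (H : ReducedLieNDeriv n e f ψ γ) {h w : A} (hh : h * e = e * h)
    (hw : Peirce e f w) :
    Peirce e f (h * w - w * h) ∧
    e * ψ (h * w - w * h) * f =
      ψ h * w - w * ψ h + (h * (e * ψ w * f) - (e * ψ w * f) * h) := by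
  have I := H.idem
  have hf : h * f = f * h := by
    rw [← add_sub_cancel_left e f, I.sum, mul_sub, sub_mul, hh, mul_one, one_mul]
  have h0 : h = e * h * e + f * h * f := by
    conv_lhs => rw [← mul_one h, ← I.sum, mul_add]
    rw [← hh, ← hf, mul_assoc, I.ee, mul_assoc, I.ff]
  have ha := Peirce.corner I.ee I.ee h
  have hb := Peirce.corner I.ff I.ff h
  set a := e * h * e
  set b := f * h * f
  have c1 : ∀ {y}, Peirce e f y → h * y - y * h = a * y - y * b := by
    intro y hy
    rw [h0, add_mul, mul_add, hb.mul_eq_zero hy I.fe, hy.mul_eq_zero ha I.fe]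
    simp
  rw [c1 hw]
  refine ⟨(ha.mul hw).sub (hw.mul hb), ?_⟩
  rw [c1 (H.ef_part w), map_sub, mul_sub, sub_mul, (H.ψ_ee_mul_ef ha hw).1,
    (H.ψ_ef_mul_ff hw hb).1, h0, map_add, add_mul, mul_add,
    (H.ψ_ff b hb).mul_eq_zero hw I.fe, hw.mul_eq_zero (H.ψ_ee a ha) I.fe]
  abel

theorem commute_defect (H : ReducedLieNDeriv n e f ψ γ) (hn : 3 ≤ n) {u v w y : A}
    (hh : (u * v - v * u) * e = e * (u * v - v * u))
    (hy : y = ψ u * v - v * ψ u + (u * ψ v - ψ v * u)) (hye : y * e = e * y)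
    (hw : Peirce e f w) :
    (y - ψ (u * v - v * u)) * w = w * (y - ψ (u * v - v * u)) := by
  have I := H.idem
  obtain ⟨hp, h1⟩ := H.ψ_diag_comm hh hw
  have h2 := (H.tail (tailSeq u v w e) (j := 2) (k := n - 3) (by omega)
    (fun i hi => by rcases i with _ | _ | _ | i <;> first | omega | rfl) hp).1
  have h2' : e * ψ ((u * v - v * u) * w - w * (u * v - v * u)) * f =
    e * (y * w - w * y + ((u * v - v * u) * ψ w - ψ w * (u * v - v * u))) * f := by
    rw [hy]; exact h2
  set h := u * v - v * u
  have hf : ∀ {z : A}, z * e = e * z → z * f = f * z := by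
    intro z hz
    rw [← add_sub_cancel_left e f, I.sum, mul_sub, sub_mul, hz, mul_one, one_mul]
  have h3 : e * (y * w - w * y + (h * ψ w - ψ w * h)) * f =
      (e * y) * (w * f) - (e * w) * (y * f) + ((e * h) * ψ w * f - e * ψ w * (h * f)) := by
    noncomm_ring
  rw [h3, ← hye, hf hye, ← hh, hf hh, hw.1, hw.2, h1] at h2'
  have h4 : y * e * w = y * w := by rw [mul_assoc, hw.1]
  have h5 : w * (f * y) = w * y := by rw [← mul_assoc, hw.2]
  rw [h4, h5] at h2'
  have h6 : (y - ψ h) * w - w * (y - ψ h) = (y * w - w * y + (h * e * ψ w * f -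
      e * ψ w * (f * h))) - (ψ h * w - w * ψ h + (h * (e * ψ w * f) - e * ψ w * f * h)) := by
    noncomm_ring
  rw [← sub_eq_zero, h6, ← h2', sub_self]

theorem isCent_defect (H : ReducedLieNDeriv n e f ψ γ) {u v y : A}
    (hh : (u * v - v * u) * e = e * (u * v - v * u))
    (hy : y = ψ u * v - v * ψ u + (u * ψ v - ψ v * u)) (hye : y * e = e * y) :
    IsCent (y - ψ (u * v - v * u)) := by
  have I := H.idem
  rcases Nat.lt_or_ge 2 n with hn | hn
  · have hf : ∀ {z : A}, z * e = e * z → z * f = f * z := by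
      intro z hz
      rw [← add_sub_cancel_left e f, I.sum, mul_sub, sub_mul, hz, mul_one, one_mul]
    have hψ : ψ (u * v - v * u) * e = e * ψ (u * v - v * u) := by
      set h := u * v - v * u
      have h0 : h = e * h * e + f * h * f := by
        conv_lhs => rw [← mul_one h, ← I.sum, mul_add]
        rw [← hh, ← hf hh, mul_assoc, I.ee, mul_assoc, I.ff]
      have ha := H.ψ_ee _ (Peirce.corner I.ee I.ee h)
      have hb := H.ψ_ff _ (Peirce.corner I.ff I.ff h)
      rw [h0, map_add, add_mul, mul_add, ha.1, ha.2, hb.right_zero I.fe, hb.left_zero I.ef]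
    refine isCent_of_commute I H.faithful H.faithful' ?_ (fun m hm => ?_) (fun t ht => ?_)
    · rw [sub_mul, mul_sub, hye, hψ]
    · exact H.commute_defect hn hh hy hye hm
    · exact H.symm.commute_defect hn (hf hh) hy (hf hye) ht
  · obtain rfl : n = 2 := le_antisymm hn H.two_le
    have h : ψ (u * v - v * u) + γ (u * v - v * u) = _ := H.lie (tailSeq u v e e)
    have h' : ψ (u * v - v * u) + γ (u * v - v * u) = y := by rw [hy]; exact h
    rw [← h', add_sub_cancel_left]
    exact H.central _

/-- The diagonal part of `[ψ m, m'] + [m, ψ m']` for `m, m' ∈ eAf`. -/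
theorem isCent_ef_ef (H : ReducedLieNDeriv n e f ψ γ) {m m' : A} (hm : Peirce e f m)
    (hm' : Peirce e f m') :
    IsCent ((m * (f * ψ m' * e) - m' * (f * ψ m * e)) +
      ((f * ψ m * e) * m' - (f * ψ m' * e) * m)) := by
  have I := H.idem
  have h0 : m * m' - m' * m = 0 := by
    rw [hm.mul_eq_zero hm' I.fe, hm'.mul_eq_zero hm I.fe, sub_zero]
  have hy : (m * (f * ψ m' * e) - m' * (f * ψ m * e)) +
      ((f * ψ m * e) * m' - (f * ψ m' * e) * m) =
      ψ m * m' - m' * ψ m + (m * ψ m' - ψ m' * m) := by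
    conv_rhs => rw [H.ψ_eq hm, H.ψ_eq hm']
    simp only [add_mul, mul_add, (H.ef_part m).mul_eq_zero hm' I.fe,
      (H.ef_part m').mul_eq_zero hm I.fe, hm.mul_eq_zero (H.ef_part m') I.fe,
      hm'.mul_eq_zero (H.ef_part m) I.fe]
    abel
  have h1 := (hm.mul (H.fe_part m')).sub (hm'.mul (H.fe_part m))
  have h2 := ((H.fe_part m).mul hm').sub ((H.fe_part m').mul hm)
  have := H.isCent_defect (u := m) (v := m') (by simp [h0]) hy
    (by rw [add_mul, mul_add, h1.1, h1.2, h2.left_zero I.ef, h2.right_zero I.fe])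
  rwa [h0, map_zero, sub_zero] at this

theorem ee_part_comm (H : ReducedLieNDeriv n e f ψ γ) {m m' b : A} (hm : Peirce e f m)
    (hm' : Peirce e f m') (hb : Peirce e e b) :
    (m * (f * ψ m' * e) - m' * (f * ψ m * e)) * b =
      b * (m * (f * ψ m' * e) - m' * (f * ψ m * e)) := by
  have I := H.idem
  have h1 := (hm.mul (H.fe_part m')).sub (hm'.mul (H.fe_part m))
  have h2 := ((H.fe_part m).mul hm').sub ((H.fe_part m').mul hm)
  have := (H.isCent_ef_ef hm hm').corner_comm hb I.ee
  rwa [mul_add, add_mul, h1.corner_eq, h2.left_zero I.ef, zero_mul, add_zero] at this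

theorem ff_part_comm (H : ReducedLieNDeriv n e f ψ γ) {m m' b : A} (hm : Peirce e f m)
    (hm' : Peirce e f m') (hb : Peirce f f b) :
    ((f * ψ m * e) * m' - (f * ψ m' * e) * m) * b =
      b * ((f * ψ m * e) * m' - (f * ψ m' * e) * m) := by
  have I := H.idem
  have h1 := (hm.mul (H.fe_part m')).sub (hm'.mul (H.fe_part m))
  have h2 := ((H.fe_part m).mul hm').sub ((H.fe_part m').mul hm)
  have := (H.isCent_ef_ef hm hm').corner_comm hb I.ff
  rwa [mul_add, add_mul, h2.corner_eq, h1.left_zero I.fe, zero_mul, zero_add] at this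

theorem ef_annihilate_of_left (H : ReducedLieNDeriv n e f ψ γ) (h2 : TorsionFreeAt A 2)
    (N : NoNonzeroCentralIdeal R A e) {m m' : A} (hm : Peirce e f m) (hm' : Peirce e f m') :
    m * (f * ψ m' * e) = 0 ∧ (f * ψ m' * e) * m = 0 := by
  have I := H.idem
  have step : ∀ {m m'}, Peirce e f m → Peirce e f m' →
      m * (f * ψ m' * e) - m' * (f * ψ m * e) = 0 := by
    intro m m' hm hm'
    refine N.eq_zero I.ee ((hm.mul (H.fe_part m')).sub (hm'.mul (H.fe_part m)))
      fun a b ha hb => ?_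
    have c1 := H.ee_part_comm (ha.mul hm) hm' hb
    have c2 := H.ee_part_comm hm (ha.mul hm') hb
    have c3 := H.ee_part_comm hm hm' ha
    rw [(H.ψ_ee_mul_ef ha hm).2] at c1
    rw [(H.ψ_ee_mul_ef ha hm').2] at c2
    set Δ := f * ψ m * e
    set Δ' := f * ψ m' * e
    have c4 : a * m * Δ' - m' * (Δ * a) + (m * (Δ' * a) - a * m' * Δ) =
        (2 : ℕ) • (a * (m * Δ' - m' * Δ)) := by
      have : a * m * Δ' - m' * (Δ * a) + (m * (Δ' * a) - a * m' * Δ) =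
          (m * Δ' - m' * Δ) * a + a * (m * Δ' - m' * Δ) := by noncomm_ring
      rw [this, c3, two_nsmul]
    have c5 : ((2 : ℕ) • (a * (m * Δ' - m' * Δ))) * b =
        b * ((2 : ℕ) • (a * (m * Δ' - m' * Δ))) := by
      rw [← c4, add_mul, mul_add, c1, c2]
    rw [← sub_eq_zero]
    apply h2
    rw [smul_sub, ← smul_mul_assoc, c5, mul_smul_comm, sub_self]
  have left : ∀ {m m'}, Peirce e f m → Peirce e f m' → m * (f * ψ m' * e) = 0 := by
    intro m m' hm hm'
    have comm : ∀ {m}, Peirce e f m → ∀ {a}, Peirce e e a →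
        m * (f * ψ m' * e) * a = a * (m * (f * ψ m' * e)) := by
      intro m hm a ha
      have c1 := step (ha.mul hm) hm'
      have c2 := step hm hm'
      rw [(H.ψ_ee_mul_ef ha hm).2, ← mul_assoc m', ← sub_eq_zero.mp c2, mul_assoc a] at c1
      exact (sub_eq_zero.mp c1).symm
    refine N.eq_zero I.ee (hm.mul (H.fe_part m')) fun a b ha hb => ?_
    rw [← mul_assoc a]
    exact comm (ha.mul hm) hb
  refine ⟨left hm hm', ?_⟩
  refine H.faithful' _ ((H.fe_part m').mul hm) (fun t ht => ?_) (fun m'' hm'' => ?_)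
  · have h := (H.ψ_ee_mul_ef (hm.mul ht) hm').2
    rw [mul_assoc m t m', (H.ψ_ef_mul_ff hm (ht.mul hm')).2, mul_assoc t,
      left hm' hm, mul_zero] at h
    rw [mul_assoc, ← h]
  · rw [← mul_assoc, left hm'' hm', zero_mul]

theorem ef_annihilate_of_right (H : ReducedLieNDeriv n e f ψ γ) (h2 : TorsionFreeAt A 2)
    (N : NoNonzeroCentralIdeal R A f) {m m' : A} (hm : Peirce e f m) (hm' : Peirce e f m') :
    m * (f * ψ m' * e) = 0 ∧ (f * ψ m' * e) * m = 0 := by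
  have I := H.idem
  have step : ∀ {m m'}, Peirce e f m → Peirce e f m' →
      (f * ψ m * e) * m' - (f * ψ m' * e) * m = 0 := by
    intro m m' hm hm'
    refine N.eq_zero I.ff (((H.fe_part m).mul hm').sub ((H.fe_part m').mul hm))
      fun a b ha hb => ?_
    have c1 := H.ff_part_comm (hm.mul ha) hm' hb
    have c2 := H.ff_part_comm hm (hm'.mul ha) hb
    have c3 := H.ff_part_comm hm hm' ha
    rw [(H.ψ_ef_mul_ff hm ha).2] at c1
    rw [(H.ψ_ef_mul_ff hm' ha).2] at c2
    set Δ := f * ψ m * e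
    set Δ' := f * ψ m' * e
    have c4 : a * Δ * m' - Δ' * (m * a) + (Δ * (m' * a) - a * Δ' * m) =
        (2 : ℕ) • (a * (Δ * m' - Δ' * m)) := by
      have : a * Δ * m' - Δ' * (m * a) + (Δ * (m' * a) - a * Δ' * m) =
          (Δ * m' - Δ' * m) * a + a * (Δ * m' - Δ' * m) := by noncomm_ring
      rw [this, c3, two_nsmul]
    have c5 : ((2 : ℕ) • (a * (Δ * m' - Δ' * m))) * b =
        b * ((2 : ℕ) • (a * (Δ * m' - Δ' * m))) := by
      rw [← c4, add_mul, mul_add, c1, c2]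
    rw [← sub_eq_zero]
    apply h2
    rw [smul_sub, ← smul_mul_assoc, c5, mul_smul_comm, sub_self]
  have right : ∀ {m m'}, Peirce e f m → Peirce e f m' → (f * ψ m' * e) * m = 0 := by
    intro m m' hm hm'
    have comm : ∀ {m'}, Peirce e f m' → ∀ {a}, Peirce f f a →
        (f * ψ m' * e) * m * a = a * ((f * ψ m' * e) * m) := by
      intro m' hm' a ha
      have c1 := step (hm'.mul ha) hm
      have c2 := step hm' hm
      rw [(H.ψ_ef_mul_ff hm' ha).2, ← mul_assoc _ m', ← sub_eq_zero.mp c2,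
        mul_assoc a] at c1
      exact (sub_eq_zero.mp c1).symm
    refine N.eq_zero I.ff ((H.fe_part m').mul hm) fun a b ha hb => ?_
    rw [← mul_assoc a, ← (H.ψ_ef_mul_ff hm' ha).2]
    exact comm (hm'.mul ha) hb
  refine ⟨?_, right hm hm'⟩
  refine H.faithful _ (hm.mul (H.fe_part m')) (fun m'' hm'' => ?_) (fun t ht => ?_)
  · rw [mul_assoc, right hm'' hm', mul_zero]
  · have h := (H.ψ_ef_mul_ff hm' (ht.mul hm)).2
    rw [← mul_assoc, (H.ψ_ee_mul_ef (hm'.mul ht) hm).2, ← mul_assoc, right hm' hm, zero_mul] at h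
    rw [← mul_assoc, ← h]

theorem ef_annihilate (H : ReducedLieNDeriv n e f ψ γ) (h2 : TorsionFreeAt A 2)
    (N : NoNonzeroCentralIdeal R A e ∨ NoNonzeroCentralIdeal R A f) {m m' : A}
    (hm : Peirce e f m) (hm' : Peirce e f m') :
    m * (f * ψ m' * e) = 0 ∧ (f * ψ m' * e) * m = 0 :=
  N.elim (fun N => H.ef_annihilate_of_left h2 N hm hm')
    (fun N => H.ef_annihilate_of_right h2 N hm hm')

/-- The defect of the Leibniz rule on `[m, t]` with `m ∈ eAf` and `t ∈ fAe`. -/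
theorem isCent_ef_fe (H : ReducedLieNDeriv n e f ψ γ) {m t : A} (hm : Peirce e f m)
    (ht : Peirce f e t) :
    IsCent ((e * ψ m * f * t + m * (f * ψ t * e) - ψ (m * t)) -
      (t * (e * ψ m * f) + f * ψ t * e * m - ψ (t * m))) := by
  have I := H.idem
  have hy : (e * ψ m * f * t + m * (f * ψ t * e)) - (t * (e * ψ m * f) + f * ψ t * e * m) =
      ψ m * t - t * ψ m + (m * ψ t - ψ t * m) := by
    conv_rhs => rw [H.ψ_eq hm, H.symm.ψ_eq ht]
    simp only [add_mul, mul_add, (H.fe_part m).mul_eq_zero ht I.ef,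
      (H.ef_part t).mul_eq_zero hm I.fe, ht.mul_eq_zero (H.fe_part m) I.ef,
      hm.mul_eq_zero (H.ef_part t) I.fe]
    abel
  have h1 := ((H.ef_part m).mul ht).add (hm.mul (H.fe_part t))
  have h2 := (ht.mul (H.ef_part m)).add ((H.fe_part t).mul hm)
  have h3 := hm.mul ht
  have h4 := ht.mul hm
  have := H.isCent_defect (u := m) (v := t)
    (by rw [sub_mul, mul_sub, h3.1, h3.2, h4.left_zero I.ef, h4.right_zero I.fe]) hy
    (by rw [sub_mul, mul_sub, h1.1, h1.2, h2.left_zero I.ef, h2.right_zero I.fe])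
  rw [map_sub] at this
  convert this using 1
  abel

theorem ψ_ef_mul_fe_of_left (H : ReducedLieNDeriv n e f ψ γ) (N : NoNonzeroCentralIdeal R A e)
    {m t : A} (hm : Peirce e f m) (ht : Peirce f e t) :
    ψ (m * t) = e * ψ m * f * t + m * (f * ψ t * e) ∧
      ψ (t * m) = t * (e * ψ m * f) + f * ψ t * e * m := by
  have I := H.idem
  have pA : ∀ {m}, Peirce e f m → Peirce e e (e * ψ m * f * t + m * (f * ψ t * e) - ψ (m * t)) :=
    fun {m} hm =>
      (((H.ef_part m).mul ht).add (hm.mul (H.fe_part t))).sub (H.ψ_ee _ (hm.mul ht))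
  have pB : ∀ {m}, Peirce e f m → Peirce f f (t * (e * ψ m * f) + f * ψ t * e * m - ψ (t * m)) :=
    fun {m} hm =>
      ((ht.mul (H.ef_part m)).add ((H.fe_part t).mul hm)).sub (H.ψ_ff _ (ht.mul hm))
  have h0 : e * ψ m * f * t + m * (f * ψ t * e) - ψ (m * t) = 0 := by
    refine N.eq_zero I.ee (pA hm) fun a b ha hb => ?_
    have hc := (H.isCent_ef_fe (ha.mul hm) ht).corner_comm hb I.ee
    rw [mul_sub, sub_mul, (pA (ha.mul hm)).corner_eq, (pB (ha.mul hm)).left_zero I.ef, zero_mul,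
      sub_zero, (H.ψ_ee_mul_ef ha hm).1, mul_assoc a m t, H.ψ_ee_mul_ee ha (hm.mul ht)] at hc
    have : (ψ a * m + a * (e * ψ m * f)) * t + a * m * (f * ψ t * e) -
        (ψ a * (m * t) + a * ψ (m * t)) =
        a * (e * ψ m * f * t + m * (f * ψ t * e) - ψ (m * t)) := by noncomm_ring
    rwa [this] at hc
  have hc := H.isCent_ef_fe hm ht
  have h1 := hc.eq_zero_of_corner I H.faithful'
    (by rw [h0, zero_sub, mul_neg, (pB hm).left_zero I.ef, neg_zero, zero_mul])
  rw [h0, zero_sub, neg_eq_zero] at h1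
  exact ⟨(sub_eq_zero.mp h0).symm, (sub_eq_zero.mp h1).symm⟩

theorem ψ_ef_mul_fe (H : ReducedLieNDeriv n e f ψ γ)
    (N : NoNonzeroCentralIdeal R A e ∨ NoNonzeroCentralIdeal R A f)
    {m t : A} (hm : Peirce e f m) (ht : Peirce f e t) :
    ψ (m * t) = e * ψ m * f * t + m * (f * ψ t * e) := by
  rcases N with N | N
  · exact (H.ψ_ef_mul_fe_of_left N hm ht).1
  · rw [(H.symm.ψ_ef_mul_fe_of_left N ht hm).2, add_comm]

/-- The off-diagonal swapping part of `ψ`. -/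
def swapPart (e f : A) (ψ : A →ₗ[R] A) : A →ₗ[R] A where
  toFun x := f * ψ (e * x * f) * e + e * ψ (f * x * e) * f
  map_add' x y := by simp only [mul_add, add_mul, map_add]; abel
  map_smul' r x := by simp

theorem swapPart_apply (x : A) :
    swapPart e f ψ x = f * ψ (e * x * f) * e + e * ψ (f * x * e) * f := rfl

theorem swapPart_symm : swapPart f e ψ = swapPart e f ψ := by
  ext x
  rw [swapPart_apply, swapPart_apply, add_comm]

theorem swapPart_ee (I : ComplIdem e f) {x : A} (hx : Peirce e e x) : swapPart e f ψ x = 0 := by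
  rw [swapPart_apply, hx.left_zero I.fe, mul_assoc e, hx.right_zero I.ef]
  simp

theorem swapPart_ef (I : ComplIdem e f) {x : A} (hx : Peirce e f x) :
    swapPart e f ψ x = f * ψ x * e := by
  rw [swapPart_apply, hx.left_zero I.fe, hx.corner_eq]
  simp

theorem swapPart_fe (I : ComplIdem e f) {x : A} (hx : Peirce f e x) :
    swapPart e f ψ x = e * ψ x * f := by
  rw [← swapPart_symm, swapPart_ef I.symm hx]

theorem swapPart_ff (I : ComplIdem e f) {x : A} (hx : Peirce f f x) : swapPart e f ψ x = 0 := by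
  rw [← swapPart_symm, swapPart_ee I.symm hx]

theorem sub_swapPart_ef (H : ReducedLieNDeriv n e f ψ γ) {x : A} (hx : Peirce e f x) :
    (ψ - swapPart e f ψ) x = e * ψ x * f := by
  rw [LinearMap.sub_apply, swapPart_ef H.idem hx, sub_eq_iff_eq_add]
  exact H.ψ_eq hx

theorem sub_swapPart_fe (H : ReducedLieNDeriv n e f ψ γ) {x : A} (hx : Peirce f e x) :
    (ψ - swapPart e f ψ) x = f * ψ x * e := by
  rw [← swapPart_symm, H.symm.sub_swapPart_ef hx]

theorem sub_swapPart_ee (H : ReducedLieNDeriv n e f ψ γ) {x : A} (hx : Peirce e e x) :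
    (ψ - swapPart e f ψ) x = ψ x := by
  rw [LinearMap.sub_apply, swapPart_ee H.idem hx, sub_zero]

theorem sub_swapPart_ff (H : ReducedLieNDeriv n e f ψ γ) {x : A} (hx : Peirce f f x) :
    (ψ - swapPart e f ψ) x = ψ x := by
  rw [LinearMap.sub_apply, swapPart_ff H.idem hx, sub_zero]

theorem sub_swapPart_peirce (H : ReducedLieNDeriv n e f ψ γ) {g h : A} (hg : g = e ∨ g = f)
    (hh : h = e ∨ h = f) {x : A} (hx : Peirce g h x) :
    Peirce g h ((ψ - swapPart e f ψ) x) := by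
  rcases hg with rfl | rfl <;> rcases hh with rfl | rfl
  · rw [H.sub_swapPart_ee hx]; exact H.ψ_ee x hx
  · rw [H.sub_swapPart_ef hx]; exact H.ef_part x
  · rw [H.sub_swapPart_fe hx]; exact H.fe_part x
  · rw [H.sub_swapPart_ff hx]; exact H.ψ_ff x hx

theorem sub_swapPart_mul_of_left (H : ReducedLieNDeriv n e f ψ γ)
    (N : NoNonzeroCentralIdeal R A e ∨ NoNonzeroCentralIdeal R A f) {h l : A}
    (hh : h = e ∨ h = f) (hl : l = e ∨ l = f) {x y : A} (hx : Peirce e h x)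
    (hy : Peirce h l y) :
    (ψ - swapPart e f ψ) (x * y) =
      (ψ - swapPart e f ψ) x * y + x * (ψ - swapPart e f ψ) y := by
  rcases hh with rfl | rfl <;> rcases hl with rfl | rfl
  · rw [H.sub_swapPart_ee hx, H.sub_swapPart_ee hy, H.sub_swapPart_ee (hx.mul hy),
      H.ψ_ee_mul_ee hx hy]
  · rw [H.sub_swapPart_ee hx, H.sub_swapPart_ef hy, H.sub_swapPart_ef (hx.mul hy),
      (H.ψ_ee_mul_ef hx hy).1]
  · rw [H.sub_swapPart_ef hx, H.sub_swapPart_fe hy, H.sub_swapPart_ee (hx.mul hy),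
      H.ψ_ef_mul_fe N hx hy]
  · rw [H.sub_swapPart_ef hx, H.sub_swapPart_ff hy, H.sub_swapPart_ef (hx.mul hy),
      (H.ψ_ef_mul_ff hx hy).1]

theorem isDeriv_sub_swapPart (H : ReducedLieNDeriv n e f ψ γ)
    (N : NoNonzeroCentralIdeal R A e ∨ NoNonzeroCentralIdeal R A f) :
    IsDeriv (ψ - swapPart e f ψ) := by
  intro x y
  have I := H.idem
  set d := ψ - swapPart e f ψ with hd
  rw [← sub_eq_zero]
  refine I.biadditive_ext (fun x y => d (x * y) - (d x * y + x * d y))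
    (fun x x' y => by simp only [add_mul, map_add]; abel)
    (fun x y y' => by simp only [mul_add, map_add]; abel) ?_ x y
  intro g h k l hg hh hk hl x y hx hy
  have hdx := H.sub_swapPart_peirce hg hh hx
  have hdy := H.sub_swapPart_peirce hk hl hy
  rw [← hd] at hdx hdy
  have orth : h * k = 0 → d (x * y) - (d x * y + x * d y) = 0 := fun h0 => by
    rw [hx.mul_eq_zero hy h0, hdx.mul_eq_zero hy h0, hx.mul_eq_zero hdy h0]
    simp
  by_cases hhk : h = k
  · subst hhk
    rw [sub_eq_zero]
    rcases hg with rfl | rfl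
    · exact H.sub_swapPart_mul_of_left N hh hl hx hy
    · rw [hd, ← swapPart_symm]
      exact H.symm.sub_swapPart_mul_of_left N.symm hh.symm hl.symm hx hy
  · apply orth
    rcases hh with rfl | rfl <;> rcases hk with rfl | rfl
    · exact absurd rfl hhk
    · exact I.ef
    · exact I.fe
    · exact absurd rfl hhk

theorem swapPart_mul_of_left (H : ReducedLieNDeriv n e f ψ γ) (h2 : TorsionFreeAt A 2)
    (N : NoNonzeroCentralIdeal R A e ∨ NoNonzeroCentralIdeal R A f) {h k l : A}
    (hh : h = e ∨ h = f) (hk : k = e ∨ k = f) (hl : l = e ∨ l = f) {x y : A}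
    (hx : Peirce e h x) (hy : Peirce k l y) :
    swapPart e f ψ (x * y) = swapPart e f ψ y * x + y * swapPart e f ψ x := by
  have I := H.idem
  have zero : ∀ {p q : A}, p = 0 → q = 0 → (0 : A) = p + q := by
    rintro _ _ rfl rfl; exact (add_zero 0).symm
  rcases hh with rfl | rfl
  · rw [swapPart_ee I hx, mul_zero, add_zero]
    rcases hk with rfl | rfl <;> rcases hl with rfl | rfl
    · rw [swapPart_ee I hy, swapPart_ee I (hx.mul hy), zero_mul]
    · rw [swapPart_ef I hy, swapPart_ef I (hx.mul hy), (H.ψ_ee_mul_ef hx hy).2]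
    · rw [hx.mul_eq_zero hy I.ef, map_zero, swapPart_fe I hy,
        (H.ef_part y).mul_eq_zero hx I.fe]
    · rw [hx.mul_eq_zero hy I.ef, map_zero, swapPart_ff I hy, zero_mul]
  · rw [swapPart_ef I hx]
    rcases hk with rfl | rfl <;> rcases hl with rfl | rfl
    · rw [hx.mul_eq_zero hy I.fe, map_zero, swapPart_ee I hy, zero_mul, zero_add,
        hy.mul_eq_zero (H.fe_part x) I.ef]
    · rw [hx.mul_eq_zero hy I.fe, map_zero, swapPart_ef I hy]
      exact zero (H.ef_annihilate h2 N hx hy).2 (H.ef_annihilate h2 N hy hx).1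
    · rw [swapPart_ee I (hx.mul hy), swapPart_fe I hy]
      exact zero ((H.ef_part y).mul_eq_zero hx I.fe) (hy.mul_eq_zero (H.fe_part x) I.ef)
    · rw [swapPart_ef I (hx.mul hy), swapPart_ff I hy, (H.ψ_ef_mul_ff hx hy).2, zero_mul,
        zero_add]

theorem isAntiDeriv_swapPart (H : ReducedLieNDeriv n e f ψ γ) (h2 : TorsionFreeAt A 2)
    (N : NoNonzeroCentralIdeal R A e ∨ NoNonzeroCentralIdeal R A f) :
    IsAntiDeriv (swapPart e f ψ) := by
  intro x y
  set δ := swapPart e f ψ with hδ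
  rw [← sub_eq_zero]
  refine H.idem.biadditive_ext (fun x y => δ (x * y) - (δ y * x + y * δ x))
    (fun x x' y => by simp only [add_mul, mul_add, map_add]; abel)
    (fun x y y' => by simp only [add_mul, mul_add, map_add]; abel) ?_ x y
  intro g h k l hg hh hk hl x y hx hy
  rw [sub_eq_zero]
  rcases hg with rfl | rfl
  · exact H.swapPart_mul_of_left h2 N hh hk hl hx hy
  · rw [hδ, ← swapPart_symm]
    exact H.symm.swapPart_mul_of_left h2 N.symm hh.symm hk.symm hl.symm hx hy

theorem swapPart_eq_zero_of_even (H : ReducedLieNDeriv n e f ψ γ) (h2 : TorsionFreeAt A 2)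
    (hn : Odd (n - 1)) (x : A) : swapPart e f ψ x = 0 := by
  have key : ∀ {y : A}, (-1 : ℤ) ^ (n - 1) • y = y → y = 0 := fun {y} h => by
    rw [hn.neg_one_pow, neg_smul, one_smul] at h
    apply h2
    rw [two_nsmul]
    conv_lhs => arg 1; rw [← h]
    exact neg_add_cancel y
  have I := H.idem
  rw [swapPart_apply, key (H.antisymm_parity (Peirce.corner I.ee I.ff x)),
    key (H.symm.antisymm_parity (Peirce.corner I.ff I.ee x)), add_zero]

theorem vanishes_γ (H : ReducedLieNDeriv n e f ψ γ) (h2 : TorsionFreeAt A 2)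
    (N : NoNonzeroCentralIdeal R A e ∨ NoNonzeroCentralIdeal R A f) :
    VanishesOnNCommutators n γ := by
  intro x
  have hd := H.isDeriv_sub_swapPart N
  have hδ := H.isAntiDeriv_swapPart h2 N
  have hsplit : comLeibniz ψ x (n - 1) = comLeibniz (ψ - swapPart e f ψ) x (n - 1) +
      comLeibniz (swapPart e f ψ) x (n - 1) := by
    rw [← comLeibniz_add]
    congr 1
    ext y
    simp
  have hδ' : comLeibniz (swapPart e f ψ) x (n - 1) = swapPart e f ψ (pCom x (n - 1)) := by
    rw [comLeibniz_of_antideriv _ (fun x y => map_sub _ x y) hδ]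
    · rcases Nat.even_or_odd (n - 1) with hn | hn
      · rw [hn.neg_one_pow, one_smul]
      · rw [H.swapPart_eq_zero_of_even h2 hn, smul_zero]
    · exact hδ.commute_commutator
  have hl := H.lie x
  rw [hsplit, hδ', comLeibniz_of_deriv _ (fun x y => map_sub _ x y) hd, LinearMap.sub_apply,
    sub_add_cancel] at hl
  simpa using hl

theorem isSingularJordanDeriv_swapPart (H : ReducedLieNDeriv n e (1 - e) ψ γ)
    (h2 : TorsionFreeAt A 2)
    (N : NoNonzeroCentralIdeal R A e ∨ NoNonzeroCentralIdeal R A (1 - e)) :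
    IsSingularJordanDeriv e (swapPart e (1 - e) ψ) := by
  have I := H.idem
  refine ⟨(H.isAntiDeriv_swapPart h2 N).isJordanDeriv,
    fun a => swapPart_ee I (Peirce.corner I.ee I.ee a),
    fun b => swapPart_ff I (Peirce.corner I.ff I.ff b), fun m => ?_, fun t => ?_⟩
  · rw [swapPart_ef I (Peirce.corner I.ee I.ff m)]
    exact (H.fe_part _).corner_eq.symm
  · rw [swapPart_fe I (Peirce.corner I.ff I.ee t)]
    exact (H.ef_part _).corner_eq.symm

end ReducedLieNDeriv

end Reduced

section Reduction

variable {R : Type*} {A : Type*} [CommRing R] [Ring A] [Algebra R A] {n : ℕ} {e f : A}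
  {φ : A →ₗ[R] A}

theorem isLieNDeriv_iff (hn : 1 ≤ n) :
    IsLieNDeriv n φ ↔ ∀ x, φ (pCom x (n - 1)) = comLeibniz φ x (n - 1) := by
  obtain ⟨k, rfl⟩ : ∃ k, n = k + 1 := ⟨n - 1, by omega⟩
  simp only [IsLieNDeriv, sum_pCom_update (fun y => φ y), Nat.add_sub_cancel]

/-- An eigenvector of `[·, e]` lying in `gAh`, with eigenvalue `ε = ±1`, commutes with `φ e`. -/
theorem IsLieNDeriv.commute_apply_of_eigen (hφ : IsLieNDeriv n φ) (hn : 2 ≤ n)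
    (hn1 : TorsionFreeAt A (n - 1)) {g h m : A} {ε : ℤ} (hε : ε * ε = 1)
    (hP : ∀ y, g * (y * e - e * y) * h = ε • (g * y * h)) (hme : m * e - e * m = ε • m)
    (hc : Peirce g h (m * φ e - φ e * m)) : φ e * m = m * φ e := by
  set c := φ e with hc'
  set x := tailSeq m e e e
  have hx : ∀ i, x (i + 1) = e := fun i => by rcases i with _ | _ | i <;> rfl
  have key : ∀ k : ℕ, pCom x k = ε ^ k • m ∧ g * comLeibniz φ x k * h =
      ε ^ k • (g * φ m * h + ((k : ℤ) * ε) • (m * c - c * m)) := by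
    intro k
    induction k with
    | zero => simp [pCom, comLeibniz, x, tailSeq]
    | succ k ih =>
      constructor
      · rw [pCom, hx, ih.1, smul_mul_assoc, mul_smul_comm, ← smul_sub, hme, smul_smul, pow_succ]
      · rw [comLeibniz, hx, ih.1, ← hc', smul_mul_assoc, mul_smul_comm, ← smul_sub, mul_add,
          add_mul, hP, ih.2, mul_smul_comm, smul_mul_assoc, hc.corner_eq]
        simp only [smul_add, smul_smul]
        rw [add_assoc, ← add_smul]
        congr 2
        · ring
        · push_cast
          linear_combination (-(ε ^ k)) * hε
  have hεp : ε ^ (n - 1) * ε ^ (n - 1) = 1 := by rw [← mul_pow, hε, one_pow]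
  have h1 := (isLieNDeriv_iff (by omega)).mp hφ x
  obtain ⟨h2, h3⟩ := key (n - 1)
  rw [← h1, h2, map_zsmul, mul_smul_comm, smul_mul_assoc] at h3
  have h4 := congrArg (ε ^ (n - 1) • ·) h3
  simp only [smul_smul, hεp, one_smul] at h4
  have h5 := congrArg (ε • ·) (left_eq_add.mp h4)
  simp only [smul_smul, smul_zero] at h5
  rw [mul_left_comm, hε, mul_one, natCast_zsmul] at h5
  exact (sub_eq_zero.mp (hn1 _ h5)).symm

/-- The map `y ↦ [y, e]`. -/
def adRight (e y : A) : A := y * e - e * y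

theorem ComplIdem.adRight_iterate (I : ComplIdem e f) (y : A) (k : ℕ) :
    e * (adRight e)^[k] y * f = (-1 : ℤ) ^ k • (e * y * f) ∧
      f * (adRight e)^[k] y * e = f * y * e := by
  induction k with
  | zero => simp
  | succ k ih =>
    rw [Function.iterate_succ_apply']
    set z := (adRight e)^[k] y
    have h1 : e * adRight e z * f = e * z * (e * f) - (e * e) * z * f := by
      rw [adRight]; noncomm_ring
    have h2 : f * adRight e z * e = f * z * (e * e) - (f * e) * z * e := by
      rw [adRight]; noncomm_ring
    rw [h1, h2, I.ef, I.ee, I.fe, ih.2, ih.1, pow_succ]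
    simp

theorem ComplIdem.adRight_iterate_diag (I : ComplIdem e f) (y : A) {k : ℕ} (hk : k ≠ 0) :
    e * (adRight e)^[k] y * e = 0 ∧ f * (adRight e)^[k] y * f = 0 := by
  obtain ⟨k, rfl⟩ := Nat.exists_eq_succ_of_ne_zero hk
  rw [Function.iterate_succ_apply']
  set z := (adRight e)^[k] y
  have h1 : e * adRight e z * e = e * z * (e * e) - (e * e) * z * e := by
    rw [adRight]; noncomm_ring
  have h2 : f * adRight e z * f = f * z * (e * f) - (f * e) * z * f := by
    rw [adRight]; noncomm_ring
  rw [h1, h2, I.ef, I.ee, I.fe]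
  simp

theorem ComplIdem.off_diag_of_iterate (I : ComplIdem e f) {y : A} {k : ℕ}
    (h : (adRight e)^[k] y = 0) : e * y * f = 0 ∧ f * y * e = 0 := by
  have h1 := I.adRight_iterate y k
  rw [h, mul_zero, mul_zero, zero_mul, zero_mul] at h1
  refine ⟨?_, h1.2.symm⟩
  rcases neg_one_pow_eq_or ℤ k with h | h <;> rw [h] at h1 <;> simpa using h1.1.symm

theorem IsLieNDeriv.apply_iterate (hφ : IsLieNDeriv n φ) (hn : 2 ≤ n) (hc : IsCent (φ e))
    (x : ℕ → A) {j k : ℕ} (hjk : j + k = n - 1) (hx : ∀ i, j < i → x i = e) :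
    φ ((adRight e)^[k] (pCom x j)) = (adRight e)^[k] (comLeibniz φ x j) := by
  have key : ∀ i, pCom x (j + i) = (adRight e)^[i] (pCom x j) ∧
      comLeibniz φ x (j + i) = (adRight e)^[i] (comLeibniz φ x j) := by
    intro i
    induction i with
    | zero => simp
    | succ i ih =>
      have hxe : x (j + i + 1) = e := hx _ (by omega)
      rw [Function.iterate_succ_apply', Function.iterate_succ_apply', ← ih.1, ← ih.2, ← add_assoc,
        pCom, comLeibniz, hxe, hc, sub_self, add_zero]
      exact ⟨rfl, rfl⟩
  have h := (isLieNDeriv_iff (by omega)).mp hφ x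
  rwa [← hjk, (key k).1, (key k).2] at h

theorem IsLieNDeriv.apply_iterate_zero (hφ : IsLieNDeriv n φ) (hn : 2 ≤ n) (hc : IsCent (φ e))
    (x : A) : φ ((adRight e)^[n - 1] x) = (adRight e)^[n - 1] (φ x) :=
  hφ.apply_iterate hn hc (tailSeq x e e e) (zero_add _)
    (fun i hi => by rcases i with _ | _ | _ | i <;> first | omega | rfl)

theorem adRight_iterate_of_eigen {x : A} {ε : ℤ} (h : x * e - e * x = ε • x) (k : ℕ) :
    (adRight e)^[k] x = ε ^ k • x := by
  induction k with
  | zero => simp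
  | succ k ih =>
    rw [Function.iterate_succ_apply', ih, adRight, smul_mul_assoc, mul_smul_comm, ← smul_sub, h,
      smul_smul, pow_succ]

theorem ComplIdem.adRight_ef (I : ComplIdem e f) {m : A} (hm : Peirce e f m) :
    m * e - e * m = (-1 : ℤ) • m := by
  rw [hm.1, hm.right_zero I.fe, zero_sub, neg_smul, one_smul]

theorem ComplIdem.adRight_fe (I : ComplIdem e f) {t : A} (ht : Peirce f e t) :
    t * e - e * t = (1 : ℤ) • t := by
  rw [ht.2, ht.left_zero I.ef, sub_zero, one_smul]

theorem IsLieNDeriv.isCent_apply_idem (hφ : IsLieNDeriv n φ) (hn : 2 ≤ n)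
    (hn1 : TorsionFreeAt A (n - 1)) (I : ComplIdem e f) (Q : FaithfulCorner e f)
    (Q' : FaithfulCorner f e) (hc : φ e * e = e * φ e) : IsCent (φ e) := by
  have hcf : φ e * f = f * φ e := by
    rw [← add_sub_cancel_left e f, I.sum, mul_sub, sub_mul, hc, mul_one, one_mul]
  refine isCent_of_commute I Q Q' hc (fun m hm => ?_) (fun t ht => ?_)
  · refine hφ.commute_apply_of_eigen hn hn1 (g := e) (h := f) (ε := -1) rfl (fun y => ?_)
      (I.adRight_ef hm) ⟨?_, ?_⟩
    · simpa [adRight] using (I.adRight_iterate y 1).1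
    · rw [mul_sub, ← mul_assoc, ← mul_assoc, ← hc, hm.1, mul_assoc (φ e), hm.1]
    · rw [sub_mul, mul_assoc, mul_assoc, hcf, ← mul_assoc, hm.2]
  · refine hφ.commute_apply_of_eigen hn hn1 (g := f) (h := e) (ε := 1) rfl (fun y => ?_)
      (I.adRight_fe ht) ⟨?_, ?_⟩
    · simpa [adRight] using (I.adRight_iterate y 1).2
    · rw [mul_sub, ← mul_assoc, ← mul_assoc, ← hcf, ht.1, mul_assoc (φ e), ht.1]
    · rw [sub_mul, mul_assoc, mul_assoc, hc, ← mul_assoc, ht.2]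

theorem IsLieNDeriv.apply_diag (hφ : IsLieNDeriv n φ) (hn : 2 ≤ n) (I : ComplIdem e f)
    (hc : IsCent (φ e)) {x : A} (hx : x * e = e * x) :
    e * φ x * f = 0 ∧ f * φ x * e = 0 := by
  have h := hφ.apply_iterate_zero hn hc x
  have h0 : (adRight e)^[n - 1] x = 0 := by
    rw [adRight_iterate_of_eigen (ε := 0) (by rw [hx, sub_self, zero_smul]),
      zero_pow (by omega), zero_smul]
  rw [h0, map_zero] at h
  exact I.off_diag_of_iterate h.symm

theorem IsLieNDeriv.apply_off_diag (hφ : IsLieNDeriv n φ) (hn : 2 ≤ n) (I : ComplIdem e f)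
    (hc : IsCent (φ e)) {x : A} {ε : ℤ} (hε : ε * ε = 1) (hx : x * e - e * x = ε • x) :
    e * φ x * e = 0 ∧ f * φ x * f = 0 := by
  have h := hφ.apply_iterate_zero hn hc x
  rw [adRight_iterate_of_eigen hx, map_zsmul] at h
  have h' : φ x = ε ^ (n - 1) • (adRight e)^[n - 1] (φ x) := by
    rw [← h, smul_smul, ← mul_pow, hε, one_pow, one_smul]
  have h0 := I.adRight_iterate_diag (φ x) (k := n - 1) (by omega)
  rw [h']
  simp only [mul_smul_comm, smul_mul_assoc, h0.1, h0.2, smul_zero, and_self]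

theorem IsLieNDeriv.isCent_apply_one (hφ : IsLieNDeriv n φ) (hn : 2 ≤ n) (I : ComplIdem e f)
    (Q : FaithfulCorner e f) (Q' : FaithfulCorner f e) (hc : IsCent (φ e)) : IsCent (φ 1) := by
  obtain ⟨h1, h2⟩ := hφ.apply_diag hn I hc (x := 1) (by rw [mul_one, one_mul])
  have h0 := I.decomp (φ 1)
  rw [h1, h2, add_zero, add_zero] at h0
  have hA := Peirce.corner I.ee I.ee (φ 1)
  have hB := Peirce.corner I.ff I.ff (φ 1)
  have key : ∀ w, e * (φ 1 * w - w * φ 1) * f = 0 ∧ f * (φ 1 * w - w * φ 1) * e = 0 := by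
    intro w
    have h := hφ.apply_iterate hn hc (tailSeq 1 w e e) (j := 1) (k := n - 2) (by omega)
      (fun i hi => by rcases i with _ | _ | _ | i <;> first | omega | rfl)
    have hp : pCom (tailSeq 1 w e e) 1 = 0 := by simp [pCom, tailSeq]
    have hs : comLeibniz φ (tailSeq 1 w e e) 1 = φ 1 * w - w * φ 1 := by
      simp [comLeibniz, pCom, tailSeq]
    have hz : (adRight e)^[n - 2] (0 : A) = 0 := by
      rw [adRight_iterate_of_eigen (ε := 1) (by simp), smul_zero]
    rw [hp, hs, hz, map_zero] at h
    exact I.off_diag_of_iterate h.symm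
  refine isCent_of_commute I Q Q' ?_ (fun m hm => ?_) (fun t ht => ?_)
  · rw [h0, add_mul, mul_add, hA.1, hA.2, hB.right_zero I.fe, hB.left_zero I.ef]
  · have h := (key m).1
    rw [h0, add_mul, mul_add, hB.mul_eq_zero hm I.fe, hm.mul_eq_zero hA I.fe, add_zero, zero_add,
      ((hA.mul hm).sub (hm.mul hB)).corner_eq, sub_eq_zero] at h
    rw [h0, add_mul, mul_add, hB.mul_eq_zero hm I.fe, hm.mul_eq_zero hA I.fe, add_zero, zero_add,
      h]
  · have h := (key t).2
    rw [h0, add_mul, mul_add, hA.mul_eq_zero ht I.ef, ht.mul_eq_zero hB I.ef, add_zero, zero_add,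
      ((hB.mul ht).sub (ht.mul hA)).corner_eq, sub_eq_zero] at h
    rw [h0, add_mul, mul_add, hA.mul_eq_zero ht I.ef, ht.mul_eq_zero hB I.ef, add_zero, zero_add,
      h]

/-- The inner derivation `x ↦ [x, s]`. -/
def innerDeriv (R : Type*) {A : Type*} [CommRing R] [Ring A] [Algebra R A] (s : A) : A →ₗ[R] A :=
  LinearMap.mulRight R s - LinearMap.mulLeft R s

theorem innerDeriv_apply (s x : A) : innerDeriv R s x = x * s - s * x := rfl

theorem isDeriv_innerDeriv (s : A) : IsDeriv (innerDeriv R s) := by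
  intro x y
  simp only [innerDeriv_apply]
  noncomm_ring

theorem IsLieNDeriv.sub_deriv (hφ : IsLieNDeriv n φ) (hn : 1 ≤ n) {d : A →ₗ[R] A}
    (hd : IsDeriv d) : IsLieNDeriv n (φ - d) := by
  rw [isLieNDeriv_iff hn] at hφ ⊢
  intro x
  have h : comLeibniz φ x (n - 1) = comLeibniz (φ - d) x (n - 1) + comLeibniz d x (n - 1) := by
    rw [← comLeibniz_add]
    congr 1
    ext y
    simp
  rw [LinearMap.sub_apply, hφ, h, comLeibniz_of_deriv d (fun x y => map_sub d x y) hd,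
    add_sub_cancel_right]

/-- A linear map whose values agree with central elements in the corner `fAf` lifts to a
central-valued linear map. -/
theorem exists_central_lift (H : ComplIdem e f) (Q : FaithfulCorner e f) (g : A →ₗ[R] A)
    (hg : ∀ a, ∃ z, IsCent z ∧ f * g a * f = f * z * f) :
    ∃ γ : A →ₗ[R] A, (∀ a, IsCent (γ a)) ∧ ∀ a, f * g a * f = f * γ a * f := by
  choose z hz hgz using hg
  have uniq : ∀ {u v : A}, IsCent u → IsCent v → f * u * f = f * v * f → u = v := by
    intro u v hu hv h
    rw [← sub_eq_zero]
    refine IsCent.eq_zero_of_corner (fun y => ?_) H.symm Q ?_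
    · rw [sub_mul, mul_sub, hu, hv]
    · rw [mul_sub, sub_mul, h, sub_self]
  refine ⟨{ toFun := z, map_add' := fun a b => ?_, map_smul' := fun r a => ?_ }, hz, hgz⟩
  · refine uniq (hz _) (fun y => by rw [add_mul, mul_add, hz, hz]) ?_
    rw [← hgz, map_add, mul_add, add_mul, hgz, hgz, mul_add, add_mul]
  · refine uniq (hz _) (fun y => ?_) ?_
    · rw [RingHom.id_apply, smul_mul_assoc, mul_smul_comm, hz]
    · rw [← hgz, map_smul, RingHom.id_apply, mul_smul_comm, smul_mul_assoc, hgz, mul_smul_comm,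
        smul_mul_assoc]

theorem PropQ.faithfulCorner (hQ : PropQ e) (he : e * e = e) :
    FaithfulCorner e (1 - e) := by
  intro a ha hm ht
  have h := hQ.1 a
  rw [ha.corner_eq] at h
  exact h ⟨fun y => hm _ (Peirce.corner he (by rw [mul_sub, mul_one, sub_mul, he]; simp) y),
    fun y => ht _ (Peirce.corner (by rw [mul_sub, mul_one, sub_mul, he]; simp) he y)⟩

theorem PropQ.faithfulCorner_compl (hQ : PropQ e) (he : e * e = e) :
    FaithfulCorner (1 - e) e := by
  intro b hb ht hm
  have h := hQ.2 b
  rw [hb.corner_eq] at h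
  exact h ⟨fun y => hm _ (Peirce.corner he (by rw [mul_sub, mul_one, sub_mul, he]; simp) y),
    fun y => ht _ (Peirce.corner (by rw [mul_sub, mul_one, sub_mul, he]; simp) he y)⟩

/-- A Lie `n`-derivation whose value at `e` is block diagonal and which satisfies the centrality
conditions on the corners splits into a reduced pair. -/
theorem IsLieNDeriv.exists_reduced (hφ : IsLieNDeriv n φ) (hn : 2 ≤ n)
    (hn1 : TorsionFreeAt A (n - 1)) (I : ComplIdem e f) (Q : FaithfulCorner e f)
    (Q' : FaithfulCorner f e) (hc : φ e * e = e * φ e)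
    (hA : ∀ a, ∃ z, IsCent z ∧ f * φ (e * a * e) * f = f * z * f)
    (hB : ∀ b, ∃ z, IsCent z ∧ e * φ (f * b * f) * e = e * z * e) :
    ∃ ψ γ : A →ₗ[R] A, ReducedLieNDeriv n e f ψ γ ∧ φ = ψ + γ := by
  have hce := hφ.isCent_apply_idem hn hn1 I Q Q' hc
  have hc1 := hφ.isCent_apply_one hn I Q Q' hce
  have hcf : IsCent (φ f) := by
    intro y
    rw [← add_sub_cancel_left e f, I.sum, map_sub, sub_mul, mul_sub, hce, hc1]
  let corner : A → A →ₗ[R] A := fun g => LinearMap.mulRight R g ∘ₗ LinearMap.mulLeft R g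
  have corner_apply : ∀ g x, corner g x = g * x * g := fun _ _ => rfl
  obtain ⟨γA, hγA, hA'⟩ := exists_central_lift I Q (φ ∘ₗ corner e) hA
  obtain ⟨γB, hγB, hB'⟩ := exists_central_lift I.symm Q' (φ ∘ₗ corner f) hB
  simp only [LinearMap.comp_apply, corner_apply] at hA' hB'
  have γA_zero : ∀ x, e * x * e = 0 → γA x = 0 := fun x hx =>
    (hγA x).eq_zero_of_corner I.symm Q (by rw [← hA', hx, map_zero, mul_zero, zero_mul])
  have γB_zero : ∀ x, f * x * f = 0 → γB x = 0 := fun x hx =>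
    (hγB x).eq_zero_of_corner I Q' (by rw [← hB', hx, map_zero, mul_zero, zero_mul])
  have γ_apply : ∀ x, (γA + γB) x = γA x + γB x := fun _ => rfl
  have cent : ∀ x, IsCent ((γA + γB) x) := fun x y => by
    rw [γ_apply, add_mul, mul_add, hγA, hγB]
  have cent_comm : ∀ {z}, IsCent z → e * z * f = 0 ∧ f * z * e = 0 := fun {z} hz => by
    rw [← hz, ← hz, mul_assoc, mul_assoc, I.ef, I.fe, mul_zero]
    exact ⟨rfl, rfl⟩
  have γ_ee : ∀ {x}, Peirce e e x → (γA + γB) x = γA x := fun {x} hx => by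
    rw [γ_apply, γB_zero x (by rw [hx.left_zero I.fe, zero_mul]), add_zero]
  have γ_ff : ∀ {x}, Peirce f f x → (γA + γB) x = γB x := fun {x} hx => by
    rw [γ_apply, γA_zero x (by rw [hx.left_zero I.ef, zero_mul]), zero_add]
  have γ_ef : ∀ x, Peirce e f x → (γA + γB) x = 0 := fun x hx => by
    rw [γ_apply, γA_zero x (by rw [mul_assoc, hx.right_zero I.fe, mul_zero]),
      γB_zero x (by rw [hx.left_zero I.fe, zero_mul]), add_zero]
  have γ_fe : ∀ x, Peirce f e x → (γA + γB) x = 0 := fun x hx => by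
    rw [γ_apply, γB_zero x (by rw [mul_assoc, hx.right_zero I.ef, mul_zero]),
      γA_zero x (by rw [hx.left_zero I.ef, zero_mul]), add_zero]
  have ψ_ee : ∀ x, Peirce e e x → Peirce e e ((φ - (γA + γB)) x) := fun x hx => by
    obtain ⟨h1, h2⟩ := hφ.apply_diag hn I hce (x := x) (by rw [hx.1, hx.2])
    have h := hA' x
    rw [hx.corner_eq] at h
    rw [LinearMap.sub_apply, γ_ee hx, I.decomp (φ x - γA x)]
    simp only [mul_sub, sub_mul, h1, h2, (cent_comm (hγA x)).1, (cent_comm (hγA x)).2, h,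
      sub_self, add_zero]
    exact (Peirce.corner I.ee I.ee _).sub (Peirce.corner I.ee I.ee _)
  have ψ_ff : ∀ x, Peirce f f x → Peirce f f ((φ - (γA + γB)) x) := fun x hx => by
    obtain ⟨h1, h2⟩ := hφ.apply_diag hn I hce (x := x)
      (by rw [hx.left_zero I.ef, hx.right_zero I.fe])
    have h := hB' x
    rw [hx.corner_eq] at h
    rw [LinearMap.sub_apply, γ_ff hx, I.decomp (φ x - γB x)]
    simp only [mul_sub, sub_mul, h1, h2, (cent_comm (hγB x)).1, (cent_comm (hγB x)).2, h,
      sub_self, zero_add]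
    exact (Peirce.corner I.ff I.ff _).sub (Peirce.corner I.ff I.ff _)
  have he : Peirce e e e := ⟨I.ee, I.ee⟩
  have hf : Peirce f f f := ⟨I.ff, I.ff⟩
  refine ⟨φ - (γA + γB), γA + γB, ⟨hn, I, Q, Q', cent, γ_ef, γ_fe, ψ_ee, ψ_ff,
    fun x hx => ?_, fun x hx => ?_, ?_, ?_, fun x => ?_⟩, (sub_add_cancel _ _).symm⟩
  · rw [LinearMap.sub_apply, γ_ef x hx, sub_zero]
    exact hφ.apply_off_diag hn I hce (ε := -1) rfl (I.adRight_ef hx)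
  · rw [LinearMap.sub_apply, γ_fe x hx, sub_zero]
    exact hφ.apply_off_diag hn I hce (ε := 1) rfl (I.adRight_fe hx)
  · refine IsCent.eq_zero_of_corner (fun y => ?_) I.symm Q ?_
    · rw [LinearMap.sub_apply, sub_mul, mul_sub, hce, cent]
    · rw [(ψ_ee e he).left_zero I.fe, zero_mul]
  · refine IsCent.eq_zero_of_corner (fun y => ?_) I Q' ?_
    · rw [LinearMap.sub_apply, sub_mul, mul_sub, hcf, cent]
    · rw [(ψ_ff f hf).left_zero I.ef, zero_mul]
  · have h := (isLieNDeriv_iff (by omega)).mp hφ x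
    have hsplit : comLeibniz φ x (n - 1) =
        comLeibniz (φ - (γA + γB)) x (n - 1) + comLeibniz (γA + γB) x (n - 1) := by
      rw [← comLeibniz_add]
      congr 1
      ext y
      simp
    rw [hsplit, comLeibniz_of_central _ cent x (by omega), add_zero] at h
    rw [← h, LinearMap.sub_apply, sub_add_cancel]

end Reduction

theorem stmt_8 (R : Type*) [CommRing R] (A : Type*) [Ring A] [Algebra R A]
    (n : ℕ) (hn : 2 ≤ n)
    (h2 : TorsionFreeAt A 2) (hn1 : TorsionFreeAt A (n - 1))
    (e : A) (he : e * e = e) (he0 : e ≠ 0) (he1 : e ≠ 1) (hQ : PropQ e)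
    (φ : A →ₗ[R] A) (hφ : IsLieNDeriv n φ)
    (hi : (∀ a : A, ∃ z : A, IsCent z ∧
          (1 - e) * φ (e * a * e) * (1 - e) = (1 - e) * z * (1 - e)) ∧
        (∀ b : A, ∃ z : A, IsCent z ∧
          e * φ ((1 - e) * b * (1 - e)) * e = e * z * e))
    (hii : NoNonzeroCentralIdeal R A e ∨ NoNonzeroCentralIdeal R A (1 - e)) :
    ∃ d δ γ : A →ₗ[R] A,
      IsDeriv d ∧ IsSingularJordanDeriv e δ ∧ IsAntiDeriv δ ∧
      (∀ x : A, IsCent (γ x)) ∧ VanishesOnNCommutators n γ ∧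
      φ = d + δ + γ := by
  have I : ComplIdem e (1 - e) :=
    ⟨he, by rw [mul_sub, mul_one, sub_mul, he]; simp, by rw [mul_sub, mul_one, he, sub_self],
      by rw [sub_mul, one_mul, he, sub_self], add_sub_cancel e 1⟩
  have Q := hQ.faithfulCorner he
  have Q' := hQ.faithfulCorner_compl he
  obtain ⟨f, hf⟩ : ∃ f, f = 1 - e := ⟨_, rfl⟩
  rw [← hf] at I Q Q' hi
  set s := e * φ e * f - f * φ e * e with hs
  have hM := Peirce.corner I.ee I.ff (φ e)
  have hN := Peirce.corner I.ff I.ee (φ e)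
  have hD := isDeriv_innerDeriv (R := R) s
  have hc : (φ - innerDeriv R s) e * e = e * (φ - innerDeriv R s) e := by
    have h : (φ - innerDeriv R s) e = e * φ e * e + f * φ e * f := by
      rw [LinearMap.sub_apply, innerDeriv_apply, hs, mul_sub, sub_mul, hM.1, hN.2,
        hM.right_zero I.fe, hN.left_zero I.ef]
      conv_lhs => arg 1; rw [I.decomp (φ e)]
      abel
    have hA := Peirce.corner I.ee I.ee (φ e)
    have hB := Peirce.corner I.ff I.ff (φ e)
    rw [h, add_mul, mul_add, hA.1, hA.2, hB.left_zero I.ef, hB.right_zero I.fe]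
  have sA : ∀ {a}, Peirce e e a → f * innerDeriv R s a * f = 0 := fun {a} ha => by
    have h : f * (a * s - s * a) * f = (f * a) * s * f - f * s * (a * f) := by noncomm_ring
    rw [innerDeriv_apply, h, ha.left_zero I.fe, ha.right_zero I.ef]
    simp
  have sB : ∀ {b}, Peirce f f b → e * innerDeriv R s b * e = 0 := fun {b} hb => by
    have h : e * (b * s - s * b) * e = (e * b) * s * e - e * s * (b * e) := by noncomm_ring
    rw [innerDeriv_apply, h, hb.left_zero I.ef, hb.right_zero I.fe]
    simp
  obtain ⟨ψ, γ, H, hsum⟩ := (hφ.sub_deriv (by omega) hD).exists_reduced hn hn1 I Q Q' hc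
    (fun a => by
      rw [LinearMap.sub_apply, mul_sub, sub_mul, sA (Peirce.corner I.ee I.ee a), sub_zero]
      exact hi.1 a)
    (fun b => by
      rw [LinearMap.sub_apply, mul_sub, sub_mul, sB (Peirce.corner I.ff I.ff b), sub_zero]
      exact hi.2 b)
  subst hf
  have hd := H.isDeriv_sub_swapPart hii
  refine ⟨ψ - ReducedLieNDeriv.swapPart e (1 - e) ψ + innerDeriv R s,
    ReducedLieNDeriv.swapPart e (1 - e) ψ, γ, fun x y => ?_,
    H.isSingularJordanDeriv_swapPart h2 hii, H.isAntiDeriv_swapPart h2 hii, H.central,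
    H.vanishes_γ h2 hii, ?_⟩
  · rw [LinearMap.add_apply, LinearMap.add_apply, LinearMap.add_apply, hd, hD]
    noncomm_ring
  · rw [sub_eq_iff_eq_add.mp hsum]
    abel
end

section
/- Let A be a unital associative algebra over a commutative unital ring R that is 2-torsion free and (n−1)-torsion free, let e be a nontrivial idempotent in A and f = 1 − e, suppose A satisfies property (Q), let n ≥ 2, and let φ be a Lie n-derivation on A. Suppose at least one of the following holds: (i) eAe = S(eAe) and fAf = S(fAf); (ii) eAe = S(eAe) and Z(eAe) = eZ(A)e; (iii) fAf = S(fAf) and Z(fAf) = fZ(A)f; (iv) Z(eAe) = eZ(A)e, Z(fAf) = fZ(A)f, and in case n ≥ 3 additionally eAe or fAf satisfies condition (*). Then fφ(a)f ∈ fZ(A)f for every a ∈ eAe and eφ(b)e ∈ eZ(A)e for every b ∈ fAf. -/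
open Finset

theorem pCom_succ {A : Type*} [Ring A] (x : ℕ → A) (k : ℕ) :
    pCom x (k + 1) = pCom x k * x (k + 1) - x (k + 1) * pCom x k := rfl

/-- Two complementary orthogonal idempotents for which both corners act faithfully
on the off-diagonal Peirce components. -/
structure IsFaithfulPeircePair {A : Type*} [Ring A] (g h : A) : Prop where
  gg : g * g = g
  hh : h * h = h
  gh : g * h = 0
  hg : h * g = 0
  add_eq_one : g + h = 1
  faithful_left : ∀ x : A, g * x = x → x * g = x →
    (∀ y, x * (g * y * h) = 0) → (∀ y, (h * y * g) * x = 0) → x = 0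
  faithful_right : ∀ x : A, h * x = x → x * h = x →
    (∀ y, x * (h * y * g) = 0) → (∀ y, (g * y * h) * x = 0) → x = 0

namespace IsFaithfulPeircePair

variable {A : Type*} [Ring A] {g h : A}

theorem symm (P : IsFaithfulPeircePair g h) : IsFaithfulPeircePair h g :=
  ⟨P.hh, P.gg, P.hg, P.gh, by rw [add_comm, P.add_eq_one], P.faithful_right, P.faithful_left⟩

theorem of_propQ {e : A} (he : e * e = e) (hQ : PropQ e) :
    IsFaithfulPeircePair e (1 - e) where
  gg := he
  hh := by simp [mul_sub, sub_mul, he]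
  gh := by simp [mul_sub, he]
  hg := by simp [sub_mul, he]
  add_eq_one := by simp
  faithful_left x hl hr h1 h2 := by
    have hx : e * x * e = x := by rw [hl, hr]
    rw [← hx]
    exact hQ.1 x ⟨by rwa [hx], by rwa [hx]⟩
  faithful_right x hl hr h1 h2 := by
    have hx : (1 - e) * x * (1 - e) = x := by rw [hl, hr]
    rw [← hx]
    exact hQ.2 x ⟨by rwa [hx], by rwa [hx]⟩

theorem gg_mul (P : IsFaithfulPeircePair g h) (x : A) : g * (g * x) = g * x := by
  rw [← mul_assoc, P.gg]

theorem gh_mul (P : IsFaithfulPeircePair g h) (x : A) : g * (h * x) = 0 := by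
  rw [← mul_assoc, P.gh, zero_mul]

/-- An element of the left corner that intertwines with `b` commutes with the corner. -/
theorem corner_commute (P : IsFaithfulPeircePair g h) {a b : A}
    (ga : g * a = a) (ag : a * g = a)
    (hm : ∀ y, a * (g * y * h) = (g * y * h) * b)
    (ht : ∀ y, (h * y * g) * a = b * (h * y * g)) (y : A) :
    a * (g * y * g) = (g * y * g) * a := by
  rw [← sub_eq_zero]
  have ga' (x : A) : g * (a * x) = a * x := by rw [← mul_assoc, ga]
  have ag' (x : A) : a * (g * x) = a * x := by rw [← mul_assoc, ag]
  apply P.faithful_left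
  · simp [mul_sub, mul_assoc, P.gg_mul, ga', ag']
  · simp [sub_mul, mul_assoc, P.gg, ag]
  · intro w
    have h1 := hm (y * g * w)
    have h2 := congrArg (g * y * ·) (hm w)
    simp only [mul_assoc, sub_mul, P.gg_mul, ga', ag'] at *
    rw [h1, h2, sub_self]
  · intro w
    have h1 := ht (w * g * y)
    have h2 := congrArg (· * (y * g)) (ht w)
    simp only [mul_assoc, mul_sub, P.gg_mul, ga, ga', ag'] at *
    rw [h1, h2, sub_self]

/-- The centre is cut out by intertwining relations on the off-diagonal components. -/
theorem isCent_add (P : IsFaithfulPeircePair g h) {a b : A}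
    (ga : g * a = a) (ag : a * g = a) (hb : h * b = b) (bh : b * h = b)
    (hm : ∀ y, a * (g * y * h) = (g * y * h) * b)
    (ht : ∀ y, (h * y * g) * a = b * (h * y * g)) : IsCent (a + b) := by
  intro y
  have h1 := P.corner_commute ga ag hm ht y
  have h2 := P.symm.corner_commute hb bh (fun y => (ht y).symm) (fun y => (hm y).symm) y
  have h3 := hm y
  have h4 := ht y
  have hy : y = g * y * g + g * y * h + h * y * g + h * y * h := by
    calc y = (g + h) * y * (g + h) := by simp [P.add_eq_one]
      _ = _ := by noncomm_ring
  have ah : a * h = 0 := by rw [← ag, mul_assoc, P.gh, mul_zero]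
  have ha : h * a = 0 := by rw [← ga, ← mul_assoc, P.hg, zero_mul]
  have bg : b * g = 0 := by rw [← bh, mul_assoc, P.hg, mul_zero]
  have gb : g * b = 0 := by rw [← hb, ← mul_assoc, P.gh, zero_mul]
  have ah' (x : A) : a * (h * x) = 0 := by rw [← mul_assoc, ah, zero_mul]
  have bg' (x : A) : b * (g * x) = 0 := by rw [← mul_assoc, bg, zero_mul]
  rw [hy]
  simp only [mul_add, add_mul, mul_assoc, ah, ha, bg, gb, ah', bg', mul_zero, zero_add,
    add_zero] at *
  rw [h1, h2, h3, h4]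
  abel

theorem tail (P : IsFaithfulPeircePair g h) (x : ℕ → A) (k : ℕ)
    (hx : ∀ j, k < j → x j = h) (l : ℕ) :
    g * pCom x (k + l) * h = g * pCom x k * h := by
  induction l with
  | zero => rfl
  | succ l ih =>
    rw [← ih, ← add_assoc, pCom_succ, hx _ (by omega)]
    simp [mul_sub, mul_assoc, P.hh, P.gh_mul]

end IsFaithfulPeircePair

theorem pCom_eq_of_stable {A : Type*} [Ring A] {x : ℕ → A} {w h : A} {k : ℕ}
    (hk : pCom x k = w) (hw : w * h - h * w = w) (l : ℕ)
    (hx : ∀ j, k < j → j ≤ k + l → x j = h) : pCom x (k + l) = w := by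
  induction l with
  | zero => exact hk
  | succ l ih =>
    rw [← add_assoc, pCom_succ, ih (fun j h1 h2 => hx j h1 (by omega)), hx _ (by omega) (by omega),
      hw]

theorem pCom_eq_zero {A : Type*} [Ring A] {x : ℕ → A} {k : ℕ}
    (hk : pCom x k = 0) (l : ℕ) : pCom x (k + l) = 0 := by
  induction l with
  | zero => exact hk
  | succ l ih => rw [← add_assoc, pCom_succ, ih]; simp

/-- The elements whose image under `φ` has `h`-corner in `h Z(A) h`. -/
def HasCentralCorner {A : Type*} [Ring A] (φ : A → A) (h x : A) : Prop :=
  ∃ z : A, IsCent z ∧ h * φ x * h = h * z * h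

namespace IsLieNDeriv

variable {R A : Type*} [CommRing R] [Ring A] [Algebra R A] {n : ℕ} {φ : A →ₗ[R] A} {g h : A}

theorem offDiag_commutator (hφ : IsLieNDeriv n φ) (hn : 2 ≤ n) (P : IsFaithfulPeircePair g h)
    {x y w : A} (hxy : x * y - y * x = w) (gw : g * w = w) (wh : w * h = w) :
    g * φ w * h = g * (φ x * y - y * φ x) * h + g * (x * φ y - φ y * x) * h
      + (n - 2) • (g * (w * φ h - φ h * w) * h) := by
  obtain ⟨N, rfl⟩ := Nat.exists_eq_add_of_le' hn
  have hw : w * h - h * w = w := by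
    rw [wh, ← gw, ← mul_assoc h, P.hg, zero_mul, sub_zero]
  let s : ℕ → A := fun i => if i = 0 then x else if i = 1 then y else h
  have key := hφ s
  have e1 : pCom s (N + 2 - 1) = w := by
    rw [show N + 2 - 1 = 1 + N by omega]
    refine pCom_eq_of_stable (h := h) ?_ hw N ?_
    · simpa [pCom, s] using hxy
    · intro j h1 _
      simp [s, show j ≠ 0 by omega, show j ≠ 1 by omega]
  rw [e1, Finset.sum_range_succ', Finset.sum_range_succ'] at key
  have key := congrArg (fun t => g * t * h) key
  simp only [mul_add, add_mul, Finset.mul_sum, Finset.sum_mul] at key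
  have t0 : g * pCom (Function.update s 0 (φ (s 0))) (N + 2 - 1) * h
      = g * (φ x * y - y * φ x) * h := by
    rw [show N + 2 - 1 = 1 + N by omega, P.tail _ 1]
    · simp [pCom, s]
    · intro j hj
      simp [s, show j ≠ 0 by omega, show j ≠ 1 by omega]
  have t1 : g * pCom (Function.update s (0 + 1) (φ (s (0 + 1)))) (N + 2 - 1) * h
      = g * (x * φ y - φ y * x) * h := by
    rw [show N + 2 - 1 = 1 + N by omega, P.tail _ 1]
    · simp [pCom, s]
    · intro j hj
      simp [s, show j ≠ 0 by omega, show j ≠ 1 by omega]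
  have t2 : ∀ i ∈ Finset.range N,
      g * pCom (Function.update s (i + 1 + 1) (φ (s (i + 1 + 1)))) (N + 2 - 1) * h
      = g * (w * φ h - φ h * w) * h := by
    intro i hi
    obtain ⟨l, rfl⟩ := Nat.exists_eq_add_of_lt (Finset.mem_range.1 hi)
    rw [show i + l + 1 + 2 - 1 = (1 + i + 1) + l by omega, P.tail _ (1 + i + 1), pCom_succ,
      pCom_eq_of_stable (w := w) (h := h) (k := 1) _ hw i]
    · simp [s, show 1 + i + 1 = i + 1 + 1 by omega]
    · intro j h1 h2
      simp [s, show j ≠ 0 by omega, show j ≠ 1 by omega, show j ≠ i + 1 + 1 by omega]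
    · simpa [pCom, s] using hxy
    · intro j h1
      simp [s, show j ≠ 0 by omega, show j ≠ 1 by omega, show j ≠ i + 1 + 1 by omega]
  rw [t0, t1, Finset.sum_congr rfl t2, Finset.sum_const, Finset.card_range] at key
  rw [key, Nat.add_sub_cancel]
  abel

theorem offDiag_idempotent (hφ : IsLieNDeriv n φ) (hn : 2 ≤ n) (hn1 : TorsionFreeAt A (n - 1))
    (P : IsFaithfulPeircePair g h) {w : A} (gw : g * w = w) (wh : w * h = w) :
    g * (w * φ h - φ h * w) * h = 0 := by
  have hw : w * h - h * w = w := by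
    rw [wh, ← gw, ← mul_assoc h, P.hg, zero_mul, sub_zero]
  have key := hφ.offDiag_commutator hn P hw gw wh
  have h1 : g * (φ w * h - h * φ w) * h = g * φ w * h := by
    simp [mul_sub, mul_assoc, P.hh, P.gh_mul]
  rw [h1, add_assoc, left_eq_add] at key
  apply hn1
  rw [show n - 1 = n - 2 + 1 by omega, succ_nsmul, add_comm]
  exact key

theorem offDiag_commutator_eq (hφ : IsLieNDeriv n φ) (hn : 2 ≤ n)
    (hn1 : TorsionFreeAt A (n - 1)) (P : IsFaithfulPeircePair g h)
    {x y w : A} (hxy : x * y - y * x = w) (gw : g * w = w) (wh : w * h = w) :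
    g * φ w * h = g * (φ x * y - y * φ x) * h + g * (x * φ y - φ y * x) * h := by
  rw [hφ.offDiag_commutator hn P hxy gw wh, hφ.offDiag_idempotent hn hn1 P gw wh]
  simp

theorem offDiag_of_commute (hφ : IsLieNDeriv n φ) (hn : 2 ≤ n) (P : IsFaithfulPeircePair g h)
    {x y : A} (hxy : x * y - y * x = 0) (m : A) :
    g * ((φ x * y - y * φ x + (x * φ y - φ y * x)) * m
      - m * (φ x * y - y * φ x + (x * φ y - φ y * x))) * h = 0 := by
  obtain rfl | ⟨N, rfl⟩ : n = 2 ∨ ∃ N, n = N + 3 := by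
    rcases hn.eq_or_lt with h | h
    · exact .inl h.symm
    · exact .inr (Nat.exists_eq_add_of_le' h)
  · have key := hφ (fun i => if i = 0 then x else y)
    have hc : φ x * y - y * φ x + (x * φ y - φ y * x) = 0 := by
      simp only [pCom, Finset.sum_range_succ] at key
      simp [hxy] at key
      rw [key]
    simp [hc]
  let s : ℕ → A := fun i => if i = 0 then x else if i = 1 then y else if i = 2 then m else h
  have key := hφ s
  have e1 : pCom s (N + 3 - 1) = 0 := by
    rw [show N + 3 - 1 = 1 + (N + 1) by omega]
    exact pCom_eq_zero (by simpa [pCom, s] using hxy) _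
  rw [e1, Finset.sum_range_succ', Finset.sum_range_succ'] at key
  have t2 : ∀ i ∈ Finset.range (N + 1),
      pCom (Function.update s (i + 1 + 1) (φ (s (i + 1 + 1)))) (N + 3 - 1) = 0 := by
    intro i _
    rw [show N + 3 - 1 = 1 + (N + 1) by omega]
    exact pCom_eq_zero (by simpa [pCom, s] using hxy) _
  rw [Finset.sum_eq_zero t2, map_zero, zero_add] at key
  have key := congrArg (fun t => g * t * h) key
  have hs (j : ℕ) (hj : 2 < j) : s j = h := by
    simp [s, show j ≠ 0 by omega, show j ≠ 1 by omega, show j ≠ 2 by omega]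
  simp only [mul_add, add_mul, mul_zero, zero_mul] at key
  rw [show N + 3 - 1 = 2 + N by omega, P.tail _ 2, P.tail _ 2] at key
  · simp only [pCom, s] at key
    simp at key
    rw [key]
    noncomm_ring
  · intro j hj
    simp [hs j hj, show j ≠ 0 by omega]
  · intro j hj
    simp [hs j hj, show j ≠ 1 by omega]

theorem offDiag_left_mul (hφ : IsLieNDeriv n φ) (hn : 2 ≤ n)
    (hn1 : TorsionFreeAt A (n - 1)) (P : IsFaithfulPeircePair g h)
    {a m : A} (ga : g * a = a) (ag : a * g = a) (gm : g * m = m) (mh : m * h = m) :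
    g * φ (a * m) * h = g * φ a * g * m - m * (h * φ a * h) + a * (g * φ m * h) := by
  have ma : m * a = 0 := by rw [← mh, ← ga, mul_assoc, P.symm.gh_mul, mul_zero]
  have ah : a * h = 0 := by rw [← ag, mul_assoc, P.gh, mul_zero]
  have key := hφ.offDiag_commutator_eq hn hn1 P (x := a) (y := m) (w := a * m)
    (by rw [ma, sub_zero]) (by rw [← mul_assoc, ga]) (by rw [mul_assoc, mh])
  have ga' (x : A) : g * (a * x) = a * x := by rw [← mul_assoc, ga]
  have ag' (x : A) : a * (g * x) = a * x := by rw [← mul_assoc, ag]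
  have gm' (x : A) : g * (m * x) = m * x := by rw [← mul_assoc, gm]
  have mh' (x : A) : m * (h * x) = m * x := by rw [← mul_assoc, mh]
  rw [key]
  simp only [mul_sub, sub_mul, mul_assoc, ga', ag', gm', mh', gm, mh, ah, mul_zero, sub_zero]

theorem offDiag_right_mul (hφ : IsLieNDeriv n φ) (hn : 2 ≤ n)
    (hn1 : TorsionFreeAt A (n - 1)) (P : IsFaithfulPeircePair g h)
    {a t : A} (ga : g * a = a) (ag : a * g = a) (ht : h * t = t) (tg : t * g = t) :
    h * φ (t * a) * g = t * (g * φ a * g) - h * φ a * h * t + h * φ t * g * a := by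
  have at0 : a * t = 0 := by rw [← ag, ← ht, mul_assoc, P.gh_mul, mul_zero]
  have key := hφ.offDiag_commutator_eq hn hn1 P.symm (x := t) (y := a) (w := t * a)
    (by rw [at0, sub_zero]) (by rw [← mul_assoc, ht]) (by rw [mul_assoc, ag])
  have ha (x : A) : h * (a * x) = 0 := by rw [← ga, ← mul_assoc, ← mul_assoc, P.hg]; simp
  have ht' (x : A) : h * (t * x) = t * x := by rw [← mul_assoc, ht]
  have tg' (x : A) : t * (g * x) = t * x := by rw [← mul_assoc, tg]
  rw [key]
  simp only [mul_sub, sub_mul, mul_assoc, ga, ag, ha, ht', tg', ht, tg, sub_zero]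
  abel

theorem left_product_rule (hφ : IsLieNDeriv n φ) (hn : 2 ≤ n)
    (hn1 : TorsionFreeAt A (n - 1)) (P : IsFaithfulPeircePair g h)
    {a b m : A} (ga : g * a = a) (ag : a * g = a) (gb : g * b = b) (bg : b * g = b)
    (gm : g * m = m) (mh : m * h = m) :
    (g * φ (a * b) * g - g * φ a * g * b - a * (g * φ b * g)) * m
      = m * (h * φ (a * b) * h) - b * m * (h * φ a * h) - a * m * (h * φ b * h) := by
  have h1 := hφ.offDiag_left_mul hn hn1 P (a := a * b) (m := m)
    (by rw [← mul_assoc, ga]) (by rw [mul_assoc, bg]) gm mh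
  have h2 := hφ.offDiag_left_mul hn hn1 P (a := a) (m := b * m) ga ag
    (by rw [← mul_assoc, gb]) (by rw [mul_assoc, mh])
  rw [hφ.offDiag_left_mul hn hn1 P gb bg gm mh, ← mul_assoc a b m, h1] at h2
  rw [← sub_eq_zero] at h2 ⊢
  rw [← h2]
  noncomm_ring

theorem right_product_rule (hφ : IsLieNDeriv n φ) (hn : 2 ≤ n)
    (hn1 : TorsionFreeAt A (n - 1)) (P : IsFaithfulPeircePair g h)
    {a b t : A} (ga : g * a = a) (ag : a * g = a) (gb : g * b = b) (bg : b * g = b)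
    (ht : h * t = t) (tg : t * g = t) :
    t * (g * φ (a * b) * g - g * φ a * g * b - a * (g * φ b * g))
      = h * φ (a * b) * h * t - h * φ b * h * (t * a) - h * φ a * h * (t * b) := by
  have h1 := hφ.offDiag_right_mul hn hn1 P (a := a * b) (t := t)
    (by rw [← mul_assoc, ga]) (by rw [mul_assoc, bg]) ht tg
  have h2 := hφ.offDiag_right_mul hn hn1 P (a := b) (t := t * a) gb bg
    (by rw [← mul_assoc, ht]) (by rw [mul_assoc, ag])
  rw [hφ.offDiag_right_mul hn hn1 P ga ag ht tg, mul_assoc t a b, h1] at h2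
  rw [← sub_eq_zero] at h2 ⊢
  rw [← h2]
  noncomm_ring

end IsLieNDeriv

/-- A corner element `c` intertwining with the `h`-corner of `φ x` witnesses centrality. -/
theorem IsFaithfulPeircePair.hasCentralCorner {A : Type*} [Ring A] {g h : A}
    (P : IsFaithfulPeircePair g h) {φ : A → A} {x c : A} (gc : g * c = c) (cg : c * g = c)
    (hm : ∀ m, g * m = m → m * h = m → c * m = m * (h * φ x * h))
    (ht : ∀ t, h * t = t → t * g = t → t * c = h * φ x * h * t) :
    HasCentralCorner φ h x := by
  refine ⟨c + h * φ x * h, P.isCent_add gc cg ?_ ?_ ?_ ?_, ?_⟩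
  · simp [mul_assoc, P.symm.gg_mul]
  · simp [mul_assoc, P.hh]
  · exact fun y => hm _ (by simp [mul_assoc, P.gg_mul]) (by simp [mul_assoc, P.hh])
  · exact fun y => ht _ (by simp [mul_assoc, P.symm.gg_mul]) (by simp [mul_assoc, P.gg])
  · rw [← gc]
    simp [mul_add, mul_assoc, P.symm.gg_mul, P.symm.gh_mul, P.hh]

namespace IsLieNDeriv

variable {R A : Type*} [CommRing R] [Ring A] [Algebra R A] {n : ℕ} {φ : A →ₗ[R] A} {g h : A}

theorem hasCentralCorner_mul (hφ : IsLieNDeriv n φ) (hn : 2 ≤ n)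
    (hn1 : TorsionFreeAt A (n - 1)) (P : IsFaithfulPeircePair g h)
    {a b : A} (ga : g * a = a) (ag : a * g = a) (gb : g * b = b) (bg : b * g = b)
    (ha : HasCentralCorner φ h a) (hb : HasCentralCorner φ h b) :
    HasCentralCorner φ h (a * b) := by
  obtain ⟨z, hz, hza⟩ := ha
  obtain ⟨w, hw, hwb⟩ := hb
  refine P.hasCentralCorner (c := (g * φ (a * b) * g - g * φ a * g * b - a * (g * φ b * g))
    + z * b + w * a) ?_ ?_ ?_ ?_
  · have ga' (x : A) : g * (a * x) = a * x := by rw [← mul_assoc, ga]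
    have hz' : g * (z * b) = z * b := by rw [← mul_assoc, ← hz g, mul_assoc, gb]
    have hw' : g * (w * a) = w * a := by rw [← mul_assoc, ← hw g, mul_assoc, ga]
    simp only [mul_sub, mul_add, mul_assoc, P.gg_mul, ga', hz', hw']
  · simp only [sub_mul, add_mul, mul_assoc, P.gg, ag, bg]
  · intro m gm mh
    have key := hφ.left_product_rule hn hn1 P ga ag gb bg gm mh
    rw [hza, hwb] at key
    have h1 : b * m * (h * z * h) = z * (b * m) := by
      rw [← hz h, mul_assoc z, P.hh, ← mul_assoc, ← hz, mul_assoc, mul_assoc, mh]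
    have h2 : a * m * (h * w * h) = w * (a * m) := by
      rw [← hw h, mul_assoc w, P.hh, ← mul_assoc, ← hw, mul_assoc, mul_assoc, mh]
    rw [h1, h2] at key
    rw [add_mul, add_mul, key]
    noncomm_ring
  · intro t ht tg
    have key := hφ.right_product_rule hn hn1 P ga ag gb bg ht tg
    rw [hza, hwb] at key
    have h1 : h * w * h * (t * a) = t * (w * a) := by
      rw [← hw h, mul_assoc w, P.hh, mul_assoc, ← mul_assoc h, ht, ← mul_assoc, hw, mul_assoc]
    have h2 : h * z * h * (t * b) = t * (z * b) := by
      rw [← hz h, mul_assoc z, P.hh, mul_assoc, ← mul_assoc h, ht, ← mul_assoc, hz, mul_assoc]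
    rw [h1, h2] at key
    rw [mul_add, mul_add, key]
    noncomm_ring

theorem hasCentralCorner_commutator (hφ : IsLieNDeriv n φ) (hn : 2 ≤ n)
    (hn1 : TorsionFreeAt A (n - 1)) (P : IsFaithfulPeircePair g h)
    {a b : A} (ga : g * a = a) (ag : a * g = a) (gb : g * b = b) (bg : b * g = b) :
    HasCentralCorner φ h (a * b - b * a) := by
  have ga' (x : A) : g * (a * x) = a * x := by rw [← mul_assoc, ga]
  have gb' (x : A) : g * (b * x) = b * x := by rw [← mul_assoc, gb]
  refine P.hasCentralCorner (c := (g * φ (a * b) * g - g * φ a * g * b - a * (g * φ b * g))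
    - (g * φ (b * a) * g - g * φ b * g * a - b * (g * φ a * g))) ?_ ?_ ?_ ?_
  · simp only [mul_sub, mul_assoc, P.gg_mul, ga', gb']
  · simp only [sub_mul, mul_assoc, P.gg, ag, bg]
  · intro m gm mh
    rw [sub_mul, hφ.left_product_rule hn hn1 P ga ag gb bg gm mh,
      hφ.left_product_rule hn hn1 P gb bg ga ag gm mh, map_sub]
    noncomm_ring
  · intro t ht tg
    rw [mul_sub, hφ.right_product_rule hn hn1 P ga ag gb bg ht tg,
      hφ.right_product_rule hn hn1 P gb bg ga ag ht tg, map_sub]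
    noncomm_ring

theorem hasCentralCorner_idempotent (hφ : IsLieNDeriv n φ) (hn : 2 ≤ n)
    (hn1 : TorsionFreeAt A (n - 1)) (P : IsFaithfulPeircePair g h)
    {p : A} (gp : g * p = p) (pg : p * g = p) (pp : p * p = p) :
    HasCentralCorner φ h p := by
  have gp' (x : A) : g * (p * x) = p * x := by rw [← mul_assoc, gp]
  have pg' (x : A) : p * (g * x) = p * x := by rw [← mul_assoc, pg]
  have pp' (x : A) : p * (p * x) = p * x := by rw [← mul_assoc, pp]
  refine P.hasCentralCorner
    (c := p * φ p * p + (g - p) * φ p * (g - p)) ?_ ?_ ?_ ?_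
  · simp only [mul_sub, sub_mul, mul_add, mul_assoc, P.gg_mul, gp']
  · simp only [mul_sub, sub_mul, add_mul, mul_assoc, P.gg, pg]
  · intro m gm mh
    have key := hφ.left_product_rule hn hn1 P gp pg gp pg gm mh
    rw [pp] at key
    have k1 := congrArg (p * ·) key
    have gm' (x : A) : g * (m * x) = m * x := by rw [← mul_assoc, gm]
    have mh' (x : A) : m * (h * x) = m * x := by rw [← mul_assoc, mh]
    simp only [mul_sub, sub_mul, add_mul, mul_assoc, gp, pg', pp', gm, mh']
      at key k1 ⊢
    grind
  · intro t ht tg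
    have key := hφ.right_product_rule hn hn1 P gp pg gp pg ht tg
    rw [pp] at key
    have k1 := congrArg (· * p) key
    have ht' (x : A) : h * (t * x) = t * x := by rw [← mul_assoc, ht]
    have tg' (x : A) : t * (g * x) = t * x := by rw [← mul_assoc, tg]
    simp only [mul_sub, sub_mul, mul_add, mul_assoc, gp, pg', pp, ht, ht', tg']
      at key k1 ⊢
    grind

theorem hasCentralCorner_of_cornerGenerated (hφ : IsLieNDeriv n φ) (hn : 2 ≤ n)
    (hn1 : TorsionFreeAt A (n - 1)) (P : IsFaithfulPeircePair g h)
    (hG : CornerGenerated R g) (a : A) : HasCentralCorner φ h (g * a * g) := by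
  suffices H : ∀ x ∈ NonUnitalAlgebra.adjoin R (cornerGenSet g),
      (g * x = x ∧ x * g = x) ∧ HasCentralCorner φ h x from (H _ (hG a)).2
  intro x hx
  induction hx using NonUnitalAlgebra.adjoin_induction with
  | mem x hx =>
    rcases hx with ⟨hx, hxx⟩ | ⟨a, b, rfl⟩
    · have gx : g * x = x := by rw [hx]; simp [mul_assoc, P.gg_mul]
      have xg : x * g = x := by rw [hx]; simp [mul_assoc, P.gg]
      exact ⟨⟨gx, xg⟩, hφ.hasCentralCorner_idempotent hn hn1 P gx xg hxx⟩
    · refine ⟨⟨?_, ?_⟩, hφ.hasCentralCorner_commutator hn hn1 P ?_ ?_ ?_ ?_⟩ <;>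
        simp [mul_sub, sub_mul, mul_assoc, P.gg_mul, P.gg]
  | zero => exact ⟨by simp, 0, fun y => by simp, by simp⟩
  | add x y _ _ hx hy =>
    obtain ⟨⟨gx, xg⟩, z, hz, hzx⟩ := hx
    obtain ⟨⟨gy, yg⟩, w, hw, hwy⟩ := hy
    refine ⟨⟨by rw [mul_add, gx, gy], by rw [add_mul, xg, yg]⟩, z + w, fun v => ?_, ?_⟩
    · rw [add_mul, mul_add, hz, hw]
    · simp only [map_add, mul_add, add_mul, hzx, hwy]
  | mul x y _ _ hx hy =>
    refine ⟨⟨by rw [← mul_assoc, hx.1.1], by rw [mul_assoc, hy.1.2]⟩, ?_⟩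
    exact hφ.hasCentralCorner_mul hn hn1 P hx.1.1 hx.1.2 hy.1.1 hy.1.2 hx.2 hy.2
  | smul r x _ hx =>
    obtain ⟨⟨gx, xg⟩, z, hz, hzx⟩ := hx
    refine ⟨⟨by rw [mul_smul_comm, gx], by rw [smul_mul_assoc, xg]⟩, r • z, fun v => ?_, ?_⟩
    · rw [smul_mul_assoc, mul_smul_comm, hz]
    · simp only [map_smul, mul_smul_comm, smul_mul_assoc, hzx]

theorem isCent_corner_commutators (hφ : IsLieNDeriv n φ) (hn : 2 ≤ n)
    (P : IsFaithfulPeircePair g h) {a b : A}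
    (ga : g * a = a) (ag : a * g = a) (hb : h * b = b) (bh : b * h = b) :
    IsCent ((a * (g * φ b * g) - g * φ b * g * a) + (h * φ a * h * b - b * (h * φ a * h))) := by
  have ab : a * b = 0 := by rw [← ag, ← hb, mul_assoc, P.gh_mul, mul_zero]
  have ba : b * a = 0 := by rw [← ga, ← bh, mul_assoc, P.symm.gh_mul, mul_zero]
  have hab : a * b - b * a = 0 := by rw [ab, ba, sub_zero]
  have ga' (x : A) : g * (a * x) = a * x := by rw [← mul_assoc, ga]
  have hb' (x : A) : h * (b * x) = b * x := by rw [← mul_assoc, hb]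
  have ag' (x : A) : a * (g * x) = a * x := by rw [← mul_assoc, ag]
  have bh' (x : A) : b * (h * x) = b * x := by rw [← mul_assoc, bh]
  have gb' (x : A) : g * (b * x) = 0 := by rw [← hb, mul_assoc, P.gh_mul]
  have ha' (x : A) : h * (a * x) = 0 := by rw [← ga, mul_assoc, P.symm.gh_mul]
  have bg' (x : A) : b * (g * x) = 0 := by rw [← bh, mul_assoc, P.symm.gh_mul, mul_zero]
  have ah' (x : A) : a * (h * x) = 0 := by rw [← ag, mul_assoc, P.gh_mul, mul_zero]
  have ah : a * h = 0 := by rw [← ag, mul_assoc, P.gh, mul_zero]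
  have bg : b * g = 0 := by rw [← bh, mul_assoc, P.hg, mul_zero]
  apply P.isCent_add
  · simp only [mul_sub, mul_assoc, P.gg_mul, ga']
  · simp only [sub_mul, mul_assoc, P.gg, ag]
  · simp only [mul_sub, mul_assoc, P.symm.gg_mul, hb']
  · simp only [sub_mul, mul_assoc, P.hh, bh]
  · intro y
    rw [← sub_eq_zero, ← hφ.offDiag_of_commute hn P hab (g * y * h)]
    simp only [mul_sub, sub_mul, mul_add, add_mul, mul_assoc, P.gg_mul, P.symm.gg_mul,
      P.hh, ga', hb', ag', bh', gb', ha', bg', ah,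
      bh, ga, hb, mul_zero, zero_mul, sub_zero, add_zero, zero_add]
  · intro y
    rw [eq_comm, ← sub_eq_zero, ← hφ.offDiag_of_commute hn P.symm hab (h * y * g)]
    simp only [mul_sub, sub_mul, mul_add, add_mul, mul_assoc, P.gg_mul, P.symm.gg_mul,
      P.gg, ga', hb', ag', bh', gb', ha', ah', bg,
      ag, ga, hb, mul_zero, sub_zero, add_zero, zero_add]

end IsLieNDeriv

/-- A central element contained in one corner vanishes. -/
theorem IsFaithfulPeircePair.eq_zero_of_isCent {A : Type*} [Ring A] {g h : A}
    (P : IsFaithfulPeircePair g h) {x : A} (gx : g * x = x) (xg : x * g = x) (hx : IsCent x) :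
    x = 0 := by
  have hx0 : h * x = 0 := by rw [← gx, ← mul_assoc, P.hg, zero_mul]
  refine P.faithful_left x gx xg (fun y => ?_) fun y => ?_
  · rw [hx, mul_assoc, hx0, mul_zero]
  · rw [← hx, mul_assoc, ← mul_assoc, hx, hx0, zero_mul]

namespace IsLieNDeriv

variable {R A : Type*} [CommRing R] [Ring A] [Algebra R A] {n : ℕ} {φ : A →ₗ[R] A} {g h : A}

theorem hasCentralCorner_of_mem_cornerCenter
    (hZ : cornerCenter h = (fun z : A => h * z * h) '' centerSet A) {x : A}
    (hx : h * φ x * h ∈ cornerCenter h) : HasCentralCorner φ h x := by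
  rw [hZ] at hx
  obtain ⟨z, hz, hzx⟩ := hx
  exact ⟨z, hz, hzx.symm⟩

theorem hasCentralCorner_symm (hφ : IsLieNDeriv n φ) (hn : 2 ≤ n)
    (P : IsFaithfulPeircePair g h)
    (hG : ∀ a, HasCentralCorner φ h (g * a * g))
    (hZ : cornerCenter g = (fun z : A => g * z * g) '' centerSet A) (b : A) :
    HasCentralCorner φ g (h * b * h) := by
  refine hasCentralCorner_of_mem_cornerCenter hZ ⟨by simp [mul_assoc, P.gg, P.gg_mul], fun a => ?_⟩
  have ga : g * (g * a * g) = g * a * g := by simp [mul_assoc, P.gg_mul]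
  have ag : g * a * g * g = g * a * g := by simp [mul_assoc, P.gg]
  have hb : h * (h * b * h) = h * b * h := by simp [mul_assoc, P.symm.gg_mul]
  have bh : h * b * h * h = h * b * h := by simp [mul_assoc, P.hh]
  have key := hφ.isCent_corner_commutators hn P ga ag hb bh
  obtain ⟨z, hz, hza⟩ := hG a
  have hc : h * φ (g * a * g) * h * (h * b * h) - h * b * h * (h * φ (g * a * g) * h) = 0 := by
    have hzh (x : A) : z * (h * x) = h * (z * x) := by rw [← mul_assoc, hz, mul_assoc]
    have hzb : z * (b * h) = b * (h * z) := by rw [hz, mul_assoc]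
    rw [hza]
    simp only [mul_assoc, P.symm.gg_mul, hzh, hzb, hz h, sub_self]
  rw [hc, add_zero] at key
  have := P.eq_zero_of_isCent (by simp only [mul_sub, mul_assoc, P.gg_mul])
    (by simp only [sub_mul, mul_assoc, P.gg]) key
  exact (sub_eq_zero.1 this).symm

theorem hasCentralCorner_of_condStar (hφ : IsLieNDeriv n φ) (hn : 2 ≤ n)
    (P : IsFaithfulPeircePair g h) (hS : CornerCondStar g)
    (hZ : cornerCenter g = (fun z : A => g * z * g) '' centerSet A) (b : A) :
    HasCentralCorner φ g (h * b * h) := by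
  refine hasCentralCorner_of_mem_cornerCenter hZ
    (hS _ (by simp [mul_assoc, P.gg, P.gg_mul]) fun a => ?_)
  have ga : g * (g * a * g) = g * a * g := by simp [mul_assoc, P.gg_mul]
  have ag : g * a * g * g = g * a * g := by simp [mul_assoc, P.gg]
  have hb : h * (h * b * h) = h * b * h := by simp [mul_assoc, P.symm.gg_mul]
  have bh : h * b * h * h = h * b * h := by simp [mul_assoc, P.hh]
  have key := hφ.isCent_corner_commutators hn P ga ag hb bh
  rw [hZ]
  refine ⟨-(g * a * g * (g * φ (h * b * h) * g) - g * φ (h * b * h) * g * (g * a * g)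
      + (h * φ (g * a * g) * h * (h * b * h) - h * b * h * (h * φ (g * a * g) * h))),
    fun y => ?_, ?_⟩
  · rw [neg_mul, mul_neg, key]
  · simp only [mul_sub, sub_mul, mul_add, add_mul, mul_neg, neg_mul, mul_assoc, P.gg_mul,
      P.gh_mul, P.gg]
    simp

theorem hasCentralCorner_of_two (hφ : IsLieNDeriv 2 φ)
    (P : IsFaithfulPeircePair g h)
    (hZ : cornerCenter h = (fun z : A => h * z * h) '' centerSet A) (a : A) :
    HasCentralCorner φ h (g * a * g) := by
  refine hasCentralCorner_of_mem_cornerCenter hZ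
    ⟨by simp [mul_assoc, P.hh, P.symm.gg_mul], fun b => ?_⟩
  have key := hφ (fun i => if i = 0 then g * a * g else h * b * h)
  simp only [pCom, Finset.sum_range_succ] at key
  simp [mul_assoc, P.gh_mul, P.symm.gh_mul] at key
  have key := congrArg (fun t => h * t * h) key
  simp [mul_add, add_mul, mul_sub, sub_mul, mul_assoc, P.hh, P.gh,
    P.symm.gh_mul, P.symm.gg_mul] at key
  simpa [mul_assoc, P.symm.gg_mul, P.hh] using (sub_eq_zero.1 key.symm)

end IsLieNDeriv

theorem stmt_10 (R : Type*) [CommRing R] (A : Type*) [Ring A] [Algebra R A]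
    (n : ℕ) (hn : 2 ≤ n)
    (h2 : TorsionFreeAt A 2) (hn1 : TorsionFreeAt A (n - 1))
    (e : A) (he : e * e = e) (he0 : e ≠ 0) (he1 : e ≠ 1) (hQ : PropQ e)
    (φ : A →ₗ[R] A) (hφ : IsLieNDeriv n φ)
    (hyp :
      (CornerGenerated R e ∧ CornerGenerated R (1 - e)) ∨
      (CornerGenerated R e ∧
        cornerCenter e = (fun z : A => e * z * e) '' centerSet A) ∨
      (CornerGenerated R (1 - e) ∧
        cornerCenter (1 - e) = (fun z : A => (1 - e) * z * (1 - e)) '' centerSet A) ∨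
      (cornerCenter e = (fun z : A => e * z * e) '' centerSet A ∧
        cornerCenter (1 - e) = (fun z : A => (1 - e) * z * (1 - e)) '' centerSet A ∧
        (3 ≤ n → CornerCondStar e ∨ CornerCondStar (1 - e)))) :
    (∀ a : A, ∃ z : A, IsCent z ∧
        (1 - e) * φ (e * a * e) * (1 - e) = (1 - e) * z * (1 - e)) ∧
    (∀ b : A, ∃ z : A, IsCent z ∧
        e * φ ((1 - e) * b * (1 - e)) * e = e * z * e) := by
  have P := IsFaithfulPeircePair.of_propQ he hQ
  rcases hyp with ⟨h1, h2⟩ | ⟨h1, hZ⟩ | ⟨h1, hZ⟩ | ⟨hZ, hZ', h3⟩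
  · exact ⟨hφ.hasCentralCorner_of_cornerGenerated hn hn1 P h1,
      hφ.hasCentralCorner_of_cornerGenerated hn hn1 P.symm h2⟩
  · have H := hφ.hasCentralCorner_of_cornerGenerated hn hn1 P h1
    exact ⟨H, hφ.hasCentralCorner_symm hn P H hZ⟩
  · have H := hφ.hasCentralCorner_of_cornerGenerated hn hn1 P.symm h1
    exact ⟨hφ.hasCentralCorner_symm hn P.symm H hZ, H⟩
  · rcases hn.eq_or_lt with rfl | hn3
    · exact ⟨hφ.hasCentralCorner_of_two P hZ', hφ.hasCentralCorner_of_two P.symm hZ⟩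
    · rcases h3 hn3 with hS | hS
      · have H := hφ.hasCentralCorner_of_condStar hn P hS hZ
        exact ⟨hφ.hasCentralCorner_symm hn P.symm H hZ', H⟩
      · have H := hφ.hasCentralCorner_of_condStar hn P.symm hS hZ'
        exact ⟨H, hφ.hasCentralCorner_symm hn P H hZ⟩
end
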